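/- Let α > 0, let μ₀ be a probability measure on ℝ^d, and let (μ_t)_{t∈[0,T]} be a solution to the martingale problem (MP)^α_{μ₀}. Then for every bounded Borel set A ⊆ ℝ^d and every t ∈ (0,T], almost surely α·μ_t(A) is a nonnegative integer; consequently, almost surely μ_t(A) ∈ {0, 1/α, 2/α, …, ⌊α⌋/α}. -/

import Mathlib

open MeasureTheory ProbabilityTheory Filter Set
open scoped ENNReal NNReal

noncomputable section

/-- Pairing `⟨μ, f⟩ = ∫ f dμ`. -/
def pairing {d : ℕ} (μ : ProbabilityMeasure (EuclideanSpace ℝ (Fin d)))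
    (f : EuclideanSpace ℝ (Fin d) → ℝ) : ℝ :=
  ∫ x, f x ∂(μ : Measure (EuclideanSpace ℝ (Fin d)))

/-- The Laplacian: sum of second partial derivatives. -/
def laplacian {d : ℕ} (φ : EuclideanSpace ℝ (Fin d) → ℝ) (x : EuclideanSpace ℝ (Fin d)) : ℝ :=
  ∑ i : Fin d,
    fderiv ℝ (fun y => fderiv ℝ φ y (EuclideanSpace.single i 1)) x (EuclideanSpace.single i 1)

/-- Squared norm of the gradient. -/
def gradSq {d : ℕ} (φ : EuclideanSpace ℝ (Fin d) → ℝ) (x : EuclideanSpace ℝ (Fin d)) : ℝ :=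
  ‖gradient φ x‖ ^ 2

/-- A real-valued process is a martingale on the time interval `[0, T]`
with respect to the filtration `ℱ` and measure `P`. -/
def MartingaleOn {Ω : Type*} {mΩ : MeasurableSpace Ω} (X : ℝ → Ω → ℝ)
    (ℱ : Filtration ℝ mΩ) (P : Measure Ω) (T : ℝ) : Prop :=
  (∀ t, 0 ≤ t → t ≤ T → StronglyMeasurable[ℱ t] (X t)) ∧
  ∀ s t, 0 ≤ s → s ≤ t → t ≤ T → P[X t | ℱ s] =ᵐ[P] X s

/-- Solution of the martingale problem `(MP)^α_{μ₀}` on `[0,T]`: an a.s. continuous,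
adapted probability-measure-valued process `μ` with `μ_0 = μ₀` such that for every
compactly supported smooth `φ`, the process
`M_t(φ) = ⟨μ_t, φ⟩ − ⟨μ₀, φ⟩ − (α/2)∫₀ᵗ ⟨μ_s, Δφ⟩ ds` is a martingale with
quadratic variation `∫₀ᵗ ⟨μ_s, ‖∇φ‖²⟩ ds`. -/
structure IsMPSolution (d : ℕ) (T α : ℝ) {Ω : Type*} [mΩ : MeasurableSpace Ω]
    (ℱ : Filtration ℝ mΩ) (P : Measure Ω)
    (μ0 : ProbabilityMeasure (EuclideanSpace ℝ (Fin d)))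
    (μ : ℝ → Ω → ProbabilityMeasure (EuclideanSpace ℝ (Fin d))) : Prop where
  init : ∀ᵐ ω ∂P, μ 0 ω = μ0
  cont : ∀ᵐ ω ∂P, ContinuousOn (fun t => μ t ω) (Set.Icc 0 T)
  mart : ∀ φ : EuclideanSpace ℝ (Fin d) → ℝ, ContDiff ℝ (⊤ : ℕ∞) φ → HasCompactSupport φ →
    MartingaleOn (fun t ω => pairing (μ t ω) φ - pairing μ0 φ
      - (α / 2) * ∫ s in (0:ℝ)..t, pairing (μ s ω) (laplacian φ)) ℱ P T
  qvar : ∀ φ : EuclideanSpace ℝ (Fin d) → ℝ, ContDiff ℝ (⊤ : ℕ∞) φ → HasCompactSupport φ →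
    MartingaleOn (fun t ω => (pairing (μ t ω) φ - pairing μ0 φ
      - (α / 2) * ∫ s in (0:ℝ)..t, pairing (μ s ω) (laplacian φ)) ^ 2
      - ∫ s in (0:ℝ)..t, pairing (μ s ω) (gradSq φ)) ℱ P T

/-- A bounded function that is a.e. strongly measurable with respect to `m`. -/
def BddMeas {Ω : Type*} (m : MeasurableSpace Ω) {mΩ : MeasurableSpace Ω} (P : Measure Ω)
    (f : Ω → ℝ) : Prop :=
  AEStronglyMeasurable[m] f P ∧ ∃ C, ∀ ω, |f ω| ≤ C

namespace BddMeas

variable {Ω : Type*} {m mΩ : MeasurableSpace Ω} {P : Measure Ω} {f g : Ω → ℝ}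

lemma mono {m' : MeasurableSpace Ω} (h : m ≤ m') (hf : BddMeas m P f) : BddMeas m' P f :=
  ⟨hf.1.mono h, hf.2⟩

lemma const (c : ℝ) : BddMeas m P (fun _ => c) :=
  ⟨aestronglyMeasurable_const, |c|, fun _ => le_rfl⟩

lemma add (hf : BddMeas m P f) (hg : BddMeas m P g) : BddMeas m P (fun ω => f ω + g ω) := by
  obtain ⟨hf, C, hC⟩ := hf
  obtain ⟨hg, D, hD⟩ := hg
  exact ⟨hf.add hg, C + D, fun ω => (abs_add_le _ _).trans (add_le_add (hC ω) (hD ω))⟩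

lemma mul (hf : BddMeas m P f) (hg : BddMeas m P g) : BddMeas m P (fun ω => f ω * g ω) := by
  obtain ⟨hf, C, hC⟩ := hf
  obtain ⟨hg, D, hD⟩ := hg
  refine ⟨hf.mul hg, C * D, fun ω => ?_⟩
  rw [abs_mul]
  exact mul_le_mul (hC ω) (hD ω) (abs_nonneg _) ((abs_nonneg _).trans (hC ω))

lemma const_mul (c : ℝ) (hf : BddMeas m P f) : BddMeas m P (fun ω => c * f ω) :=
  (const c).mul hf

lemma sub (hf : BddMeas m P f) (hg : BddMeas m P g) : BddMeas m P (fun ω => f ω - g ω) := by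
  simpa [sub_eq_add_neg] using hf.add (hg.const_mul (-1))

lemma pow (hf : BddMeas m P f) (n : ℕ) : BddMeas m P (fun ω => f ω ^ n) := by
  obtain ⟨hf, C, hC⟩ := hf
  refine ⟨hf.pow n, C ^ n, fun ω => ?_⟩
  rw [abs_pow]
  exact pow_le_pow_left₀ (abs_nonneg _) (hC ω) n

lemma exp (hf : BddMeas m P f) : BddMeas m P (fun ω => Real.exp (f ω)) := by
  obtain ⟨hf, C, hC⟩ := hf
  refine ⟨Real.continuous_exp.comp_aestronglyMeasurable hf, Real.exp C, fun ω => ?_⟩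
  rw [abs_of_pos (Real.exp_pos _)]
  exact Real.exp_le_exp.2 ((le_abs_self _).trans (hC ω))

lemma abs (hf : BddMeas m P f) : BddMeas m P (fun ω => |f ω|) := by
  obtain ⟨hf, C, hC⟩ := hf
  exact ⟨continuous_abs.comp_aestronglyMeasurable hf, C, fun ω => by rw [abs_abs]; exact hC ω⟩

lemma sum {ι : Type*} (s : Finset ι) {F : ι → Ω → ℝ} (hF : ∀ i ∈ s, BddMeas m P (F i)) :
    BddMeas m P (fun ω => ∑ i ∈ s, F i ω) := by
  classical
  induction s using Finset.induction_on with
  | empty => simpa using const (0 : ℝ)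
  | insert a s ha ih =>
    simp only [Finset.sum_insert ha]
    exact (hF a (by simp)).add (ih fun i hi => hF i (by simp [hi]))

lemma integrable [IsFiniteMeasure P] (hf : BddMeas mΩ P f) : Integrable f P := by
  obtain ⟨hf, C, hC⟩ := hf
  exact Integrable.of_bound hf C (ae_of_all _ hC)

end BddMeas

lemma MartingaleOn.integral_mul_eq {Ω : Type*} {mΩ : MeasurableSpace Ω} {P : Measure Ω}
    [IsProbabilityMeasure P] {ℱ : Filtration ℝ mΩ} {X : ℝ → Ω → ℝ} {T : ℝ}
    (hX : MartingaleOn X ℱ P T) {s u : ℝ} (hs : 0 ≤ s) (hsu : s ≤ u) (hu : u ≤ T) {H : Ω → ℝ}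
    (hH : BddMeas (ℱ s) P H) (hXu : BddMeas mΩ P (X u)) :
    ∫ ω, H ω * X u ω ∂P = ∫ ω, H ω * X s ω ∂P := by
  have h1 := condExp_mul_of_aestronglyMeasurable_left hH.1
    ((hH.mono (ℱ.le s)).mul hXu).integrable hXu.integrable
  have h2 := integral_condExp (f := H * X u) (μ := P) (ℱ.le s)
  change _ = ∫ ω, H ω * X u ω ∂P at h2
  rw [← h2]
  refine integral_congr_ae ?_
  filter_upwards [h1, hX.2 s u hs hsu hu] with ω h1 h3
  rw [h1, Pi.mul_apply, h3]

/-- A real semimartingale `Y` on `[0, T]` with bounded continuous drift `b` and bounded continuous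
bracket density `q`. -/
structure IsDiffusion {Ω : Type*} {mΩ : MeasurableSpace Ω} (ℱ : Filtration ℝ mΩ) (P : Measure Ω)
    (T K y₀ : ℝ) (Y b q : ℝ → Ω → ℝ) : Prop where
  meas : ∀ t, 0 ≤ t → t ≤ T → AEStronglyMeasurable[ℱ t] (Y t) P
  cont : ∀ᵐ ω ∂P, ContinuousOn (fun t => Y t ω) (Icc 0 T)
  cont_drift : ∀ᵐ ω ∂P, ContinuousOn (fun t => b t ω) (Icc 0 T)
  cont_bracket : ∀ᵐ ω ∂P, ContinuousOn (fun t => q t ω) (Icc 0 T)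
  bound : ∀ t ω, |Y t ω| ≤ K
  bound_drift : ∀ t ω, |b t ω| ≤ K
  bound_bracket : ∀ t ω, |q t ω| ≤ K
  mart : MartingaleOn (fun t ω => Y t ω - y₀ - ∫ s in (0 : ℝ)..t, b s ω) ℱ P T
  mart_sq : MartingaleOn (fun t ω => (Y t ω - y₀ - ∫ s in (0 : ℝ)..t, b s ω) ^ 2
    - ∫ s in (0 : ℝ)..t, q s ω) ℱ P T

namespace IsDiffusion

variable {Ω : Type*} {mΩ : MeasurableSpace Ω} {ℱ : Filtration ℝ mΩ} {P : Measure Ω}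
  {T K y₀ : ℝ} {Y b q : ℝ → Ω → ℝ}

/-- The increment of the martingale part over `[s, u]`. -/
def incr (Y b : ℝ → Ω → ℝ) (s u : ℝ) (ω : Ω) : ℝ :=
  (Y u ω - ∫ r in (0 : ℝ)..u, b r ω) - (Y s ω - ∫ r in (0 : ℝ)..s, b r ω)

lemma abs_integral_le {f : ℝ → Ω → ℝ} (hf : ∀ t ω, |f t ω| ≤ K) (s u : ℝ) (ω : Ω) :
    |∫ r in s..u, f r ω| ≤ K * |u - s| :=
  intervalIntegral.norm_integral_le_of_norm_le_const (f := fun r => f r ω) fun r _ => hf r ω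

lemma bddMeas (h : IsDiffusion ℱ P T K y₀ Y b q) {t : ℝ} (h0 : 0 ≤ t) (hT : t ≤ T) :
    BddMeas (ℱ t) P (Y t) :=
  ⟨h.meas t h0 hT, K, h.bound t⟩

lemma bddMeas_integral_drift (h : IsDiffusion ℱ P T K y₀ Y b q) {t : ℝ} (h0 : 0 ≤ t)
    (hT : t ≤ T) : BddMeas (ℱ t) P (fun ω => ∫ r in (0 : ℝ)..t, b r ω) := by
  refine ⟨?_, _, abs_integral_le h.bound_drift 0 t⟩
  have h1 := ((h.meas t h0 hT).sub
    (aestronglyMeasurable_const (b := y₀))).sub (h.mart.1 t h0 hT).aestronglyMeasurable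
  refine h1.congr (ae_of_all _ fun ω => ?_)
  simp

lemma bddMeas_mart (h : IsDiffusion ℱ P T K y₀ Y b q) {t : ℝ} (h0 : 0 ≤ t) (hT : t ≤ T) :
    BddMeas (ℱ t) P (fun ω => Y t ω - y₀ - ∫ r in (0 : ℝ)..t, b r ω) :=
  ((h.bddMeas h0 hT).sub (.const _)).sub (h.bddMeas_integral_drift h0 hT)

lemma bddMeas_integral_bracket (h : IsDiffusion ℱ P T K y₀ Y b q) {t : ℝ} (h0 : 0 ≤ t)
    (hT : t ≤ T) : BddMeas (ℱ t) P (fun ω => ∫ r in (0 : ℝ)..t, q r ω) := by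
  refine ⟨?_, _, abs_integral_le h.bound_bracket 0 t⟩
  have h1 := ((h.bddMeas_mart h0 hT).pow 2).1.sub (h.mart_sq.1 t h0 hT).aestronglyMeasurable
  refine h1.congr (ae_of_all _ fun ω => ?_)
  simp

lemma bddMeas_incr (h : IsDiffusion ℱ P T K y₀ Y b q) {s u : ℝ} (hs : 0 ≤ s) (hsu : s ≤ u)
    (hu : u ≤ T) : BddMeas (ℱ u) P (incr Y b s u) :=
  ((h.bddMeas (hs.trans hsu) hu).sub (h.bddMeas_integral_drift (hs.trans hsu) hu)).sub
    (((h.bddMeas hs (hsu.trans hu)).sub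
      (h.bddMeas_integral_drift hs (hsu.trans hu))).mono (ℱ.mono hsu))

variable [IsProbabilityMeasure P]

lemma integral_mul_incr (h : IsDiffusion ℱ P T K y₀ Y b q) {s u : ℝ} (hs : 0 ≤ s) (hsu : s ≤ u)
    (hu : u ≤ T) {H : Ω → ℝ} (hH : BddMeas (ℱ s) P H) :
    ∫ ω, H ω * incr Y b s u ω ∂P = 0 := by
  have hu0 := hs.trans hsu
  have hsT := hsu.trans hu
  have hMu := (h.bddMeas_mart hu0 hu).mono (ℱ.le u)
  have hMs := (h.bddMeas_mart hs hsT).mono (ℱ.le s)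
  have hH' := hH.mono (ℱ.le s)
  have h1 := h.mart.integral_mul_eq hs hsu hu hH hMu
  rw [← sub_eq_zero, ← integral_sub (hH'.mul hMu).integrable (hH'.mul hMs).integrable] at h1
  rw [← h1]
  congr 1 with ω
  simp only [incr]
  ring

lemma integral_mul_incr_sq (h : IsDiffusion ℱ P T K y₀ Y b q) {s u : ℝ} (hs : 0 ≤ s)
    (hsu : s ≤ u) (hu : u ≤ T) {H : Ω → ℝ} (hH : BddMeas (ℱ s) P H) :
    ∫ ω, H ω * incr Y b s u ω ^ 2 ∂P
      = ∫ ω, H ω * ((∫ r in (0 : ℝ)..u, q r ω) - ∫ r in (0 : ℝ)..s, q r ω) ∂P := by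
  have hu0 := hs.trans hsu
  have hsT := hsu.trans hu
  have hMu := (h.bddMeas_mart hu0 hu).mono (ℱ.le u)
  have hMs := (h.bddMeas_mart hs hsT).mono (ℱ.le s)
  have hQu := (h.bddMeas_integral_bracket hu0 hu).mono (ℱ.le u)
  have hQs := (h.bddMeas_integral_bracket hs hsT).mono (ℱ.le s)
  have hH' := hH.mono (ℱ.le s)
  have hi := (h.bddMeas_incr hs hsu hu).mono (ℱ.le u)
  have h1 := h.mart_sq.integral_mul_eq hs hsu hu hH ((hMu.pow 2).sub hQu)
  have h2 := h.integral_mul_incr hs hsu hu (hH.mul (h.bddMeas_mart hs hsT))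
  rw [← sub_eq_zero, ← integral_sub (hH'.mul ((hMu.pow 2).sub hQu)).integrable
    (hH'.mul ((hMs.pow 2).sub hQs)).integrable] at h1
  rw [← sub_eq_zero, ← integral_sub (hH'.mul (hi.pow 2)).integrable
    (hH'.mul (hQu.sub hQs)).integrable]
  have h3 : ∫ ω, (-2) * (H ω * (Y s ω - y₀ - ∫ r in (0 : ℝ)..s, b r ω) * incr Y b s u ω) ∂P
      = 0 := by
    rw [integral_const_mul, h2, mul_zero]
  have h4 := congrArg₂ (· + ·) h1 h3
  rw [← integral_add ((hH'.mul ((hMu.pow 2).sub hQu)).sub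
    (hH'.mul ((hMs.pow 2).sub hQs))).integrable
    (((hH'.mul hMs).mul hi).const_mul (-2)).integrable, add_zero] at h4
  refine Eq.trans ?_ h4
  congr 1 with ω
  simp only [incr]
  ring

end IsDiffusion

namespace IsDiffusion

variable {Ω : Type*} {mΩ : MeasurableSpace Ω} {ℱ : Filtration ℝ mΩ} {P : Measure Ω}
  {T K y₀ : ℝ} {Y b q : ℝ → Ω → ℝ}

lemma intervalIntegrable_of_continuousOn {f : ℝ → ℝ} (hf : ContinuousOn f (Icc 0 T)) {s u : ℝ}
    (hs : 0 ≤ s) (hsu : s ≤ u) (hu : u ≤ T) : IntervalIntegrable f volume s u := by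
  refine ContinuousOn.intervalIntegrable ?_
  rw [uIcc_of_le hsu]
  exact hf.mono (Icc_subset_Icc hs hu)

lemma integral_sub_eq_of_continuousOn {f : ℝ → ℝ} (hf : ContinuousOn f (Icc 0 T)) {s u : ℝ}
    (hs : 0 ≤ s) (hsu : s ≤ u) (hu : u ≤ T) :
    (∫ r in (0 : ℝ)..u, f r) - (∫ r in (0 : ℝ)..s, f r) = ∫ r in s..u, f r :=
  intervalIntegral.integral_interval_sub_left
    (intervalIntegrable_of_continuousOn hf le_rfl (hs.trans hsu) hu)
    (intervalIntegrable_of_continuousOn hf le_rfl hs (hsu.trans hu))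

lemma abs_integral_sub_le {f : ℝ → Ω → ℝ} (hf : ∀ t ω, |f t ω| ≤ K) {ω : Ω}
    (hc : ContinuousOn (fun t => f t ω) (Icc 0 T)) {s u : ℝ} (hs : 0 ≤ s) (hsu : s ≤ u)
    (hu : u ≤ T) :
    |(∫ r in (0 : ℝ)..u, f r ω) - ∫ r in (0 : ℝ)..s, f r ω| ≤ K * (u - s) := by
  rw [integral_sub_eq_of_continuousOn hc hs hsu hu]
  simpa [abs_of_nonneg (sub_nonneg.2 hsu)] using abs_integral_le hf s u ω

lemma abs_incr_le (h : IsDiffusion ℱ P T K y₀ Y b q) {s u : ℝ} (hs : 0 ≤ s) (hsu : s ≤ u)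
    (hu : u ≤ T) (ω : Ω) : |incr Y b s u ω| ≤ 2 * K + 2 * K * T := by
  have hK : 0 ≤ K := (abs_nonneg _).trans (h.bound 0 ω)
  have h1 := abs_integral_le h.bound_drift 0 u ω
  have h2 := abs_integral_le h.bound_drift 0 s ω
  have h3 : K * |u - 0| ≤ K * T := by
    rw [sub_zero, abs_of_nonneg (hs.trans hsu)]; gcongr
  have h4 : K * |s - 0| ≤ K * T := by
    rw [sub_zero, abs_of_nonneg hs]; gcongr; exact hsu.trans hu
  have := abs_le.1 (h.bound u ω)
  have := abs_le.1 (h.bound s ω)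
  have := abs_le.1 h1
  have := abs_le.1 h2
  rw [incr, abs_le]
  constructor <;> linarith

/-- The remainder in the second order expansion of `exp (Y u)` around `Y s`. -/
def remainder (Y b : ℝ → Ω → ℝ) (s u : ℝ) (ω : Ω) : ℝ :=
  Real.exp (Y u ω) - Real.exp (Y s ω) - Real.exp (Y s ω) *
    (incr Y b s u ω + ((∫ r in (0 : ℝ)..u, b r ω) - ∫ r in (0 : ℝ)..s, b r ω)
      + incr Y b s u ω ^ 2 / 2)

lemma abs_exp_sub_le (x : ℝ) : |Real.exp x - 1 - x - x ^ 2 / 2| ≤ |x| ^ 3 * Real.exp |x| := by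
  have h := Complex.norm_exp_sub_sum_le_norm_mul_exp (x : ℂ) 3
  have h2 : Complex.exp x - ∑ m ∈ Finset.range 3, (x : ℂ) ^ m / (m.factorial : ℂ)
      = ((Real.exp x - 1 - x - x ^ 2 / 2 : ℝ) : ℂ) := by
    simp [Finset.sum_range_succ, Nat.factorial]
    ring
  rwa [h2, Complex.norm_real, Complex.norm_real, Real.norm_eq_abs, Real.norm_eq_abs] at h


lemma abs_remainder_le (h : IsDiffusion ℱ P T K y₀ Y b q) {s u δ : ℝ} (hs : 0 ≤ s) (hsu : s ≤ u)
    (hu : u ≤ T) {ω : Ω} (hc : ContinuousOn (fun t => b t ω) (Icc 0 T))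
    (hδ : |Y u ω - Y s ω| ≤ δ) (hδK : δ ≤ 2 * K) :
    |remainder Y b s u ω| ≤ Real.exp K * ((δ + 2 * K * (u - s)) * (K * (u - s))
      + 2 * Real.exp (2 * K) * (δ * incr Y b s u ω ^ 2 + 2 * K * (K * (u - s)) ^ 2)) := by
  have hK : 0 ≤ K := (abs_nonneg _).trans (h.bound 0 ω)
  have hδ0 : 0 ≤ δ := (abs_nonneg _).trans hδ
  set D := Y u ω - Y s ω with hD
  set β := (∫ r in (0 : ℝ)..u, b r ω) - ∫ r in (0 : ℝ)..s, b r ω with hβ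
  set m := incr Y b s u ω with hm
  have hDm : D = m + β := by rw [hD, hβ, hm, incr]; ring
  have hβb : |β| ≤ K * (u - s) := abs_integral_sub_le h.bound_drift hc hs hsu hu
  have hη : 0 ≤ u - s := sub_nonneg.2 hsu
  have hexp : remainder Y b s u ω = Real.exp (Y s ω) *
      ((D * β - β ^ 2 / 2) + (Real.exp D - 1 - D - D ^ 2 / 2)) := by
    have : Real.exp (Y u ω) = Real.exp (Y s ω) * Real.exp D := by
      rw [← Real.exp_add, hD]; ring_nf
    rw [remainder, this, hDm]
    ring
  have h1 : |D * β - β ^ 2 / 2| ≤ (δ + 2 * K * (u - s)) * (K * (u - s)) := by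
    calc |D * β - β ^ 2 / 2| = |D - β / 2| * |β| := by rw [← abs_mul]; ring_nf
      _ ≤ (δ + 2 * K * (u - s)) * (K * (u - s)) := by
        gcongr
        have := abs_le.1 hδ
        have := abs_le.1 hβb
        have : 0 ≤ K * (u - s) := by positivity
        rw [abs_le]
        constructor <;> linarith
  have h2 : |Real.exp D - 1 - D - D ^ 2 / 2|
      ≤ 2 * Real.exp (2 * K) * (δ * m ^ 2 + 2 * K * (K * (u - s)) ^ 2) := by
    have hD2 : D ^ 2 ≤ 2 * m ^ 2 + 2 * (K * (u - s)) ^ 2 := by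
      have : β ^ 2 ≤ (K * (u - s)) ^ 2 := sq_le_sq' (by linarith [abs_le.1 hβb]) (abs_le.1 hβb).2
      rw [hDm]; nlinarith [sq_nonneg (m - β)]
    calc _ ≤ |D| ^ 3 * Real.exp |D| := abs_exp_sub_le D
      _ = (|D| * D ^ 2) * Real.exp |D| := by rw [← sq_abs D]; ring
      _ ≤ (δ * (2 * m ^ 2 + 2 * (K * (u - s)) ^ 2)) * Real.exp (2 * K) := by
        gcongr
        exact hδ.trans hδK
      _ = 2 * Real.exp (2 * K) * (δ * m ^ 2 + δ * (K * (u - s)) ^ 2) := by ring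
      _ ≤ _ := by gcongr
  rw [hexp, abs_mul, abs_of_pos (Real.exp_pos _)]
  gcongr
  · exact (le_abs_self _).trans (h.bound s ω)
  · exact (abs_add_le _ _).trans (add_le_add h1 h2)

lemma bddMeas_remainder (h : IsDiffusion ℱ P T K y₀ Y b q) {s u : ℝ} (hs : 0 ≤ s) (hsu : s ≤ u)
    (hu : u ≤ T) : BddMeas mΩ P (remainder Y b s u) := by
  have hu0 := hs.trans hsu
  have hsT := hsu.trans hu
  have hYu := (h.bddMeas hu0 hu).mono (ℱ.le _)
  have hYs := (h.bddMeas hs hsT).mono (ℱ.le _)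
  have hβ := ((h.bddMeas_integral_drift hu0 hu).mono (ℱ.le _)).sub
    ((h.bddMeas_integral_drift hs hsT).mono (ℱ.le _))
  have hm := (h.bddMeas_incr hs hsu hu).mono (ℱ.le _)
  have := (hYu.exp.sub hYs.exp).sub (hYs.exp.mul ((hm.add hβ).add ((hm.pow 2).const_mul (1 / 2))))
  convert this using 2 with ω
  simp only [remainder]
  ring

section Grid

variable {τ : ℕ → ℝ}

lemma bddMeas_sum_incr_sq (h : IsDiffusion ℱ P T K y₀ Y b q) (hτ : Monotone τ)
    (hτT : ∀ i, τ i ∈ Icc 0 T) (k : ℕ) :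
    BddMeas (ℱ (τ k)) P (fun ω => ∑ i ∈ Finset.range k, incr Y b (τ i) (τ (i + 1)) ω ^ 2) :=
  BddMeas.sum _ fun i hi => ((h.bddMeas_incr (hτT i).1 (hτ i.le_succ) (hτT _).2).pow 2).mono
    (ℱ.mono (hτ (Finset.mem_range.1 hi)))

variable [IsProbabilityMeasure P]

lemma integral_mul_incr_sq_le (h : IsDiffusion ℱ P T K y₀ Y b q) {s u : ℝ} (hs : 0 ≤ s)
    (hsu : s ≤ u) (hu : u ≤ T) {H : Ω → ℝ} (hH : BddMeas (ℱ s) P H) (hH0 : ∀ ω, 0 ≤ H ω) :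
    ∫ ω, H ω * incr Y b s u ω ^ 2 ∂P ≤ K * (u - s) * ∫ ω, H ω ∂P := by
  rw [h.integral_mul_incr_sq hs hsu hu hH, ← integral_const_mul]
  have hQu := (h.bddMeas_integral_bracket (hs.trans hsu) hu).mono (ℱ.le u)
  have hQs := (h.bddMeas_integral_bracket hs (hsu.trans hu)).mono (ℱ.le s)
  have hH' := hH.mono (ℱ.le s)
  refine integral_mono_ae (hH'.mul (hQu.sub hQs)).integrable (hH'.const_mul _).integrable ?_
  filter_upwards [h.cont_bracket] with ω hω
  rw [mul_comm]
  exact mul_le_mul_of_nonneg_right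
    ((le_abs_self _).trans (abs_integral_sub_le h.bound_bracket hω hs hsu hu)) (hH0 ω)

lemma integral_sum_incr_sq_le (h : IsDiffusion ℱ P T K y₀ Y b q) (hτ : Monotone τ)
    (hτT : ∀ i, τ i ∈ Icc 0 T) (k : ℕ) :
    ∫ ω, ∑ i ∈ Finset.range k, incr Y b (τ i) (τ (i + 1)) ω ^ 2 ∂P ≤ K * (τ k - τ 0) := by
  induction k with
  | zero => simp
  | succ k ih =>
    have h1 := h.integral_mul_incr_sq_le (hτT k).1 (hτ k.le_succ) (hτT _).2
      (BddMeas.const 1) (fun _ => zero_le_one)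
    simp only [one_mul, integral_const, probReal_univ, smul_eq_mul, mul_one] at h1
    simp only [Finset.sum_range_succ]
    rw [integral_add ((h.bddMeas_sum_incr_sq hτ hτT k).mono (ℱ.le _)).integrable
      (((h.bddMeas_incr (hτT k).1 (hτ k.le_succ) (hτT _).2).pow 2).mono (ℱ.le _)).integrable]
    simp only [Nat.succ_eq_add_one] at h1
    linarith

lemma integral_sum_incr_sq_sq_le (h : IsDiffusion ℱ P T K y₀ Y b q) (hτ : Monotone τ)
    (hτT : ∀ i, τ i ∈ Icc 0 T) (k : ℕ) :
    ∫ ω, (∑ i ∈ Finset.range k, incr Y b (τ i) (τ (i + 1)) ω ^ 2) ^ 2 ∂P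
      ≤ (2 * K ^ 2 * T + (2 * K + 2 * K * T) ^ 2 * K) * (τ k - τ 0) := by
  have hne : Nonempty Ω := P.nonempty_of_neZero
  have hK : 0 ≤ K := (abs_nonneg _).trans (h.bound 0 hne.some)
  induction k with
  | zero => simp
  | succ k ih =>
    have hm := h.bddMeas_incr (hτT k).1 (hτ k.le_succ) (hτT (k + 1)).2
    have hm' := hm.mono (ℱ.le _)
    have hS := h.bddMeas_sum_incr_sq hτ hτT k
    have hS' := hS.mono (ℱ.le _)
    have h1 := h.integral_mul_incr_sq_le (hτT k).1 (hτ k.le_succ) (hτT (k + 1)).2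
      (BddMeas.const 1) (fun _ => zero_le_one)
    simp only [one_mul, integral_const, probReal_univ, smul_eq_mul, mul_one] at h1
    have h2 := h.integral_mul_incr_sq_le (hτT k).1 (hτ k.le_succ) (hτT (k + 1)).2
      hS (fun ω => Finset.sum_nonneg fun i _ => sq_nonneg _)
    have h3 : K * (τ (k + 1) - τ k) *
        ∫ ω, ∑ i ∈ Finset.range k, incr Y b (τ i) (τ (i + 1)) ω ^ 2 ∂P
        ≤ K * (τ (k + 1) - τ k) * (K * T) := by
      have := h.integral_sum_incr_sq_le hτ hτT k
      have h5 : 0 ≤ τ (k + 1) - τ k := sub_nonneg.2 (hτ k.le_succ)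
      refine mul_le_mul_of_nonneg_left (this.trans ?_) (by positivity)
      gcongr
      linarith [(hτT k).2, (hτT 0).1]
    have h4 : ∫ ω, incr Y b (τ k) (τ (k + 1)) ω ^ 4 ∂P
        ≤ (2 * K + 2 * K * T) ^ 2 * (K * (τ (k + 1) - τ k)) := by
      refine le_trans ?_ (mul_le_mul_of_nonneg_left h1 (sq_nonneg _))
      rw [← integral_const_mul]
      refine integral_mono (hm'.pow 4).integrable ((hm'.pow 2).const_mul _).integrable fun ω => ?_
      have h6 := sq_le_sq' (by linarith [(abs_le.1 (h.abs_incr_le (hτT k).1 (hτ k.le_succ)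
        (hτT (k + 1)).2 ω)).1]) (abs_le.1 (h.abs_incr_le (hτT k).1 (hτ k.le_succ)
        (hτT (k + 1)).2 ω)).2
      calc incr Y b (τ k) (τ (k + 1)) ω ^ 4
          = incr Y b (τ k) (τ (k + 1)) ω ^ 2 * incr Y b (τ k) (τ (k + 1)) ω ^ 2 := by ring
        _ ≤ _ := mul_le_mul_of_nonneg_right h6 (sq_nonneg _)
    simp only [Finset.sum_range_succ]
    have h7 : ∀ ω, (∑ i ∈ Finset.range k, incr Y b (τ i) (τ (i + 1)) ω ^ 2
          + incr Y b (τ k) (τ (k + 1)) ω ^ 2) ^ 2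
        = (∑ i ∈ Finset.range k, incr Y b (τ i) (τ (i + 1)) ω ^ 2) ^ 2
          + (2 * ((∑ i ∈ Finset.range k, incr Y b (τ i) (τ (i + 1)) ω ^ 2)
            * incr Y b (τ k) (τ (k + 1)) ω ^ 2) + incr Y b (τ k) (τ (k + 1)) ω ^ 4) := by
      intro ω; ring
    simp only [h7]
    rw [integral_add (hS'.pow 2).integrable
      (((hS'.mul (hm'.pow 2)).const_mul 2).add (hm'.pow 4)).integrable,
      integral_add ((hS'.mul (hm'.pow 2)).const_mul 2).integrable (hm'.pow 4).integrable,
      integral_const_mul]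
    simp only [Nat.succ_eq_add_one] at h2
    nlinarith

lemma integral_exp_sub (h : IsDiffusion ℱ P T K y₀ Y b q) {s u : ℝ} (hs : 0 ≤ s) (hsu : s ≤ u)
    (hu : u ≤ T) :
    ∫ ω, (Real.exp (Y u ω) - Real.exp (Y s ω)) ∂P
      = ∫ ω, Real.exp (Y s ω) * (((∫ r in (0 : ℝ)..u, b r ω) - ∫ r in (0 : ℝ)..s, b r ω)
          + ((∫ r in (0 : ℝ)..u, q r ω) - ∫ r in (0 : ℝ)..s, q r ω) / 2) ∂P
        + ∫ ω, remainder Y b s u ω ∂P := by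
  have hu0 := hs.trans hsu
  have hsT := hsu.trans hu
  have hE := (h.bddMeas hs hsT).exp
  have hE' := hE.mono (ℱ.le _)
  have hβ := ((h.bddMeas_integral_drift hu0 hu).mono (ℱ.le _)).sub
    ((h.bddMeas_integral_drift hs hsT).mono (ℱ.le _))
  have hQ := ((h.bddMeas_integral_bracket hu0 hu).mono (ℱ.le _)).sub
    ((h.bddMeas_integral_bracket hs hsT).mono (ℱ.le _))
  have hm := (h.bddMeas_incr hs hsu hu).mono (ℱ.le _)
  have h1 := h.integral_mul_incr hs hsu hu hE
  have h2 := h.integral_mul_incr_sq hs hsu hu hE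
  have h3 : ∀ ω, Real.exp (Y u ω) - Real.exp (Y s ω) = Real.exp (Y s ω) * incr Y b s u ω
      + (Real.exp (Y s ω) * ((∫ r in (0 : ℝ)..u, b r ω) - ∫ r in (0 : ℝ)..s, b r ω)
      + ((1 / 2) * (Real.exp (Y s ω) * incr Y b s u ω ^ 2) + remainder Y b s u ω)) := by
    intro ω
    simp only [remainder]
    ring
  have h4 : ∀ ω, Real.exp (Y s ω) * (((∫ r in (0 : ℝ)..u, b r ω) - ∫ r in (0 : ℝ)..s, b r ω)
          + ((∫ r in (0 : ℝ)..u, q r ω) - ∫ r in (0 : ℝ)..s, q r ω) / 2)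
      = Real.exp (Y s ω) * ((∫ r in (0 : ℝ)..u, b r ω) - ∫ r in (0 : ℝ)..s, b r ω)
        + (1 / 2) * (Real.exp (Y s ω) *
          ((∫ r in (0 : ℝ)..u, q r ω) - ∫ r in (0 : ℝ)..s, q r ω)) := by
    intro ω
    ring
  simp only [h3, h4]
  have hR := h.bddMeas_remainder hs hsu hu
  rw [integral_add (hE'.mul hm).integrable ((hE'.mul hβ).add
      (((hE'.mul (hm.pow 2)).const_mul _).add hR)).integrable,
    integral_add (hE'.mul hβ).integrable (((hE'.mul (hm.pow 2)).const_mul _).add hR).integrable,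
    integral_add ((hE'.mul (hm.pow 2)).const_mul _).integrable hR.integrable,
    integral_add (hE'.mul hβ).integrable ((hE'.mul hQ).const_mul _).integrable,
    integral_const_mul, integral_const_mul, h1, h2]
  ring

end Grid

end IsDiffusion

lemma tendsto_integral_mul_zero {Ω : Type*} {mΩ : MeasurableSpace Ω} {P : Measure Ω}
    [IsProbabilityMeasure P] {δ S : ℕ → Ω → ℝ} (hδ : ∀ n, BddMeas mΩ P (δ n))
    (hS : ∀ n, BddMeas mΩ P (S n)) (hδ0 : ∀ n ω, 0 ≤ δ n ω) (hS0 : ∀ n ω, 0 ≤ S n ω) {C : ℝ}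
    (hC : ∀ n, ∫ ω, S n ω ^ 2 ∂P ≤ C)
    (hlim : Tendsto (fun n => ∫ ω, δ n ω ^ 2 ∂P) atTop (nhds 0)) :
    Tendsto (fun n => ∫ ω, δ n ω * S n ω ∂P) atTop (nhds 0) := by
  have hC0 : 0 ≤ C := le_trans (integral_nonneg fun ω => sq_nonneg (S 0 ω)) (hC 0)
  rw [Metric.tendsto_atTop] at hlim ⊢
  intro ε hε
  have hl : 0 < ε / (C + 1) := by positivity
  obtain ⟨N, hN⟩ := hlim (ε * (ε / (C + 1))) (by positivity)
  refine ⟨N, fun n hn => ?_⟩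
  have h1 := hN n hn
  rw [Real.dist_0_eq_abs, abs_of_nonneg (integral_nonneg fun ω => sq_nonneg _)] at h1
  rw [Real.dist_0_eq_abs,
    abs_of_nonneg (integral_nonneg fun ω => mul_nonneg (hδ0 n ω) (hS0 n ω))]
  set l := ε / (C + 1) with hl'
  have h2 : ∫ ω, δ n ω * S n ω ∂P
      ≤ ∫ ω, ((1 / (2 * l)) * δ n ω ^ 2 + (l / 2) * S n ω ^ 2) ∂P := by
    refine integral_mono ((hδ n).mul (hS n)).integrable
      ((((hδ n).pow 2).const_mul _).add (((hS n).pow 2).const_mul _)).integrable fun ω => ?_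
    have : (1 / (2 * l)) * δ n ω ^ 2 + (l / 2) * S n ω ^ 2 - δ n ω * S n ω
        = (1 / (2 * l)) * (δ n ω - l * S n ω) ^ 2 := by
      field_simp
      ring
    have h3 : 0 ≤ (1 / (2 * l)) * (δ n ω - l * S n ω) ^ 2 := by positivity
    change δ n ω * S n ω ≤ (1 / (2 * l)) * δ n ω ^ 2 + (l / 2) * S n ω ^ 2
    linarith
  rw [integral_add (((hδ n).pow 2).const_mul _).integrable (((hS n).pow 2).const_mul _).integrable,
    integral_const_mul, integral_const_mul] at h2
  have h4 : (1 / (2 * l)) * ∫ ω, δ n ω ^ 2 ∂P < (1 / (2 * l)) * (ε * l) :=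
    mul_lt_mul_of_pos_left h1 (by positivity)
  have h5 : (1 / (2 * l)) * (ε * l) = ε / 2 := by field_simp
  have h6 : (l / 2) * ∫ ω, S n ω ^ 2 ∂P ≤ (l / 2) * C :=
    mul_le_mul_of_nonneg_left (hC n) (by positivity)
  have h7 : l * C ≤ ε := by
    rw [hl', div_mul_eq_mul_div, div_le_iff₀ (by positivity)]
    nlinarith
  linarith

/-- The uniform grid of mesh `t / (n + 1)` on `[0, t]`, stopped at `t`. -/
def grid (t : ℝ) (n i : ℕ) : ℝ := min (i * (t / (n + 1))) t

namespace IsDiffusion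

section Grid

variable {t : ℝ}

lemma grid_mono (ht : 0 ≤ t) (n : ℕ) : Monotone (grid t n) := fun i j hij => by
  unfold grid
  gcongr

lemma grid_mem (ht : 0 ≤ t) (n i : ℕ) : grid t n i ∈ Icc 0 t :=
  ⟨le_min (by positivity) ht, min_le_right _ _⟩

lemma grid_zero (ht : 0 ≤ t) (n : ℕ) : grid t n 0 = 0 := by simp [grid, ht]

lemma grid_last (n : ℕ) : grid t n (n + 1) = t := by
  unfold grid
  push_cast
  rw [mul_div_cancel₀ _ (by positivity), min_self]

lemma grid_succ_sub_le (ht : 0 ≤ t) (n i : ℕ) : grid t n (i + 1) - grid t n i ≤ t / (n + 1) := by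
  unfold grid
  have h : 0 ≤ t / ((n : ℝ) + 1) := by positivity
  push_cast
  rcases min_choice ((i : ℝ) * (t / (n + 1))) t with h1 | h1 <;> rw [h1]
  · linarith [min_le_left (((i : ℝ) + 1) * (t / (n + 1))) t]
  · linarith [min_le_right (((i : ℝ) + 1) * (t / (n + 1))) t]

end Grid

end IsDiffusion

section Grid

variable {t : ℝ}

open IsDiffusion

lemma eventually_abs_sub_grid_le (ht : 0 ≤ t) {f : ℝ → ℝ} (hf : ContinuousOn f (Icc 0 t)) {ε : ℝ}
    (hε : 0 < ε) : ∀ᶠ n : ℕ in atTop, ∀ i, ∀ r ∈ Icc (grid t n i) (grid t n (i + 1)),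
      |f r - f (grid t n i)| ≤ ε := by
  have huc := isCompact_Icc.uniformContinuousOn_of_continuous hf
  rw [Metric.uniformContinuousOn_iff] at huc
  obtain ⟨δ, hδ, hfδ⟩ := huc ε hε
  have hlim : Tendsto (fun n : ℕ => t / ((n : ℝ) + 1)) atTop (nhds 0) :=
    tendsto_const_div_atTop_nhds_zero_nat t |>.comp (tendsto_add_atTop_nat 1) |>.congr
      fun n => by simp
  filter_upwards [hlim.eventually (gt_mem_nhds hδ)] with n hn i r hr
  have h1 := grid_mem ht n i
  have h2 := grid_mem ht n (i + 1)
  have h3 := grid_succ_sub_le ht n i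
  refine (hfδ r ⟨h1.1.trans hr.1, hr.2.trans h2.2⟩ _ h1 ?_).le
  rw [Real.dist_eq, abs_of_nonneg (by linarith [hr.1])]
  linarith [hr.2]

lemma tendsto_sum_grid_mul_integral (ht : 0 ≤ t) {f g : ℝ → ℝ} (hf : ContinuousOn f (Icc 0 t))
    (hg : ContinuousOn g (Icc 0 t)) :
    Tendsto (fun n : ℕ => ∑ i ∈ Finset.range (n + 1),
      f (grid t n i) * ∫ r in grid t n i..grid t n (i + 1), g r) atTop
      (nhds (∫ r in (0 : ℝ)..t, f r * g r)) := by
  obtain ⟨C, hC⟩ := isCompact_Icc.exists_bound_of_continuousOn hg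
  have hC0 : 0 ≤ C := (norm_nonneg _).trans (hC 0 ⟨le_rfl, ht⟩)
  rw [Metric.tendsto_atTop']
  intro ε hε
  have hε' : 0 < ε / (C * t + 1) := by positivity
  obtain ⟨N, hN⟩ := eventually_atTop.1 (eventually_abs_sub_grid_le ht hf hε')
  refine ⟨N, fun n hn => ?_⟩
  specialize hN n hn.le
  have hsub : ∀ i, uIcc (grid t n i) (grid t n (i + 1)) ⊆ Icc 0 t := fun i => by
    rw [uIcc_of_le (grid_mono ht n i.le_succ)]
    exact Icc_subset_Icc (grid_mem ht n i).1 (grid_mem ht n (i + 1)).2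
  have hfg : ∀ i, IntervalIntegrable (fun r => f r * g r) volume (grid t n i) (grid t n (i + 1)) :=
    fun i => ((hf.mul hg).mono (hsub i)).intervalIntegrable
  have hgi : ∀ i, IntervalIntegrable g volume (grid t n i) (grid t n (i + 1)) :=
    fun i => (hg.mono (hsub i)).intervalIntegrable
  have hsum := intervalIntegral.sum_integral_adjacent_intervals (a := grid t n) (n := n + 1)
    (fun i _ => hfg i)
  rw [grid_zero ht, grid_last] at hsum
  rw [dist_comm, Real.dist_eq, ← hsum, ← Finset.sum_sub_distrib]
  calc |∑ i ∈ Finset.range (n + 1), ((∫ r in grid t n i..grid t n (i + 1), f r * g r)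
        - f (grid t n i) * ∫ r in grid t n i..grid t n (i + 1), g r)|
      ≤ ∑ i ∈ Finset.range (n + 1),
        ε / (C * t + 1) * C * (grid t n (i + 1) - grid t n i) := by
        refine (Finset.abs_sum_le_sum_abs _ _).trans (Finset.sum_le_sum fun i _ => ?_)
        rw [← intervalIntegral.integral_const_mul, ← intervalIntegral.integral_sub (hfg i)
          ((hgi i).const_mul _), ← abs_of_nonneg (sub_nonneg.2 (grid_mono ht n i.le_succ))]
        rw [← Real.norm_eq_abs]
        refine intervalIntegral.norm_integral_le_of_norm_le_const (C := ε / (C * t + 1) * C)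
          fun r hr => ?_
        have hr' := uIoc_subset_uIcc hr
        rw [← sub_mul, norm_mul]
        refine mul_le_mul ?_ (hC r (hsub i hr')) (norm_nonneg _) hε'.le
        rw [uIcc_of_le (grid_mono ht n i.le_succ)] at hr'
        exact hN i r hr'
    _ = ε / (C * t + 1) * (C * t) := by
        rw [← Finset.mul_sum, Finset.sum_range_sub, grid_zero ht, grid_last]
        ring
    _ < ε := by
        rw [div_mul_eq_mul_div, div_lt_iff₀ (by positivity)]
        linarith

end Grid

namespace IsDiffusion

variable {Ω : Type*} {mΩ : MeasurableSpace Ω} {ℱ : Filtration ℝ mΩ} {P : Measure Ω}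
  {T K y₀ : ℝ} {Y b q : ℝ → Ω → ℝ} {t : ℝ}

/-- The maximal increment of `Y` along the grid. -/
def gridOsc (Y : ℝ → Ω → ℝ) (t : ℝ) (n : ℕ) (ω : Ω) : ℝ :=
  ⨆ i : Fin (n + 1), |Y (grid t n (i + 1)) ω - Y (grid t n i) ω|

lemma abs_sub_le_gridOsc {n i : ℕ} (hi : i < n + 1) (ω : Ω) :
    |Y (grid t n (i + 1)) ω - Y (grid t n i) ω| ≤ gridOsc Y t n ω :=
  le_ciSup (f := fun i : Fin (n + 1) => |Y (grid t n (i + 1)) ω - Y (grid t n i) ω|)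
    (Finite.bddAbove_range _) ⟨i, hi⟩

lemma gridOsc_nonneg (n : ℕ) (ω : Ω) : 0 ≤ gridOsc Y t n ω :=
  (abs_nonneg _).trans (abs_sub_le_gridOsc (Nat.succ_pos n) ω)

lemma gridOsc_le (h : IsDiffusion ℱ P T K y₀ Y b q) (n : ℕ) (ω : Ω) : gridOsc Y t n ω ≤ 2 * K :=
  ciSup_le fun i => by
    have h1 := abs_le.1 (h.bound (grid t n (i + 1)) ω)
    have h2 := abs_le.1 (h.bound (grid t n i) ω)
    rw [abs_le]
    constructor <;> linarith

lemma bddMeas_gridOsc (h : IsDiffusion ℱ P T K y₀ Y b q) (ht : 0 ≤ t) (htT : t ≤ T) (n : ℕ) :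
    BddMeas mΩ P (gridOsc Y t n) := by
  refine ⟨?_, 2 * K, fun ω => by rw [abs_of_nonneg (gridOsc_nonneg n ω)]; exact h.gridOsc_le n ω⟩
  refine (AEMeasurable.iSup fun i : Fin (n + 1) => ?_).aestronglyMeasurable
  have hm : ∀ j, BddMeas mΩ P (Y (grid t n j)) := fun j =>
    (h.bddMeas (grid_mem ht n j).1 ((grid_mem ht n j).2.trans htT)).mono (ℱ.le _)
  exact ((hm _).sub (hm _)).abs.1.aemeasurable

lemma tendsto_gridOsc (ht : 0 ≤ t) {ω : Ω} (hc : ContinuousOn (fun r => Y r ω) (Icc 0 t)) :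
    Tendsto (fun n => gridOsc Y t n ω) atTop (nhds 0) := by
  rw [Metric.tendsto_atTop']
  intro ε hε
  obtain ⟨N, hN⟩ := eventually_atTop.1 (eventually_abs_sub_grid_le ht hc (half_pos hε))
  refine ⟨N, fun n hn => ?_⟩
  rw [Real.dist_eq, sub_zero, abs_of_nonneg (gridOsc_nonneg n ω)]
  refine (ciSup_le fun i => ?_ : gridOsc Y t n ω ≤ ε / 2).trans_lt (half_lt_self hε)
  exact hN n hn.le i _ ⟨grid_mono ht n (Nat.le_succ _), le_rfl⟩

end IsDiffusion

namespace IsDiffusion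

variable {Ω : Type*} {mΩ : MeasurableSpace Ω} {ℱ : Filtration ℝ mΩ} {P : Measure Ω}
  {T K y₀ : ℝ} {Y b q : ℝ → Ω → ℝ} {t : ℝ}

lemma abs_sum_remainder_le (h : IsDiffusion ℱ P T K y₀ Y b q) (ht : 0 ≤ t) (htT : t ≤ T)
    (n : ℕ) {ω : Ω} (hc : ContinuousOn (fun t => b t ω) (Icc 0 T)) :
    |∑ i ∈ Finset.range (n + 1), remainder Y b (grid t n i) (grid t n (i + 1)) ω|
      ≤ Real.exp K * (K * t) * gridOsc Y t n ω
        + 2 * Real.exp K * Real.exp (2 * K) * (gridOsc Y t n ω *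
          ∑ i ∈ Finset.range (n + 1), incr Y b (grid t n i) (grid t n (i + 1)) ω ^ 2)
        + Real.exp K * (2 * K ^ 2 + 4 * Real.exp (2 * K) * K ^ 3) * t * (t / (n + 1)) := by
  have hK : 0 ≤ K := (abs_nonneg _).trans (h.bound 0 ω)
  set δ := gridOsc Y t n ω
  set η := t / ((n : ℝ) + 1)
  calc _ ≤ ∑ i ∈ Finset.range (n + 1), |remainder Y b (grid t n i) (grid t n (i + 1)) ω| :=
        Finset.abs_sum_le_sum_abs _ _
    _ ≤ ∑ i ∈ Finset.range (n + 1), ((Real.exp K * K * δ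
          + Real.exp K * (2 * K ^ 2 + 4 * Real.exp (2 * K) * K ^ 3) * η)
            * (grid t n (i + 1) - grid t n i)
        + (2 * Real.exp K * Real.exp (2 * K) * δ)
            * incr Y b (grid t n i) (grid t n (i + 1)) ω ^ 2) := by
        refine Finset.sum_le_sum fun i hi => ?_
        have h0 : 0 ≤ grid t n (i + 1) - grid t n i := sub_nonneg.2 (grid_mono ht n i.le_succ)
        have h1 : grid t n (i + 1) - grid t n i ≤ η := grid_succ_sub_le ht n i
        refine (h.abs_remainder_le (grid_mem ht n i).1 (grid_mono ht n i.le_succ)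
          ((grid_mem ht n (i + 1)).2.trans htT) hc
          (abs_sub_le_gridOsc (Finset.mem_range.1 hi) ω) (h.gridOsc_le n ω)).trans ?_
        have h2 : (grid t n (i + 1) - grid t n i) ^ 2
            ≤ η * (grid t n (i + 1) - grid t n i) := by nlinarith
        have h3 : 0 ≤ Real.exp K * (2 * K ^ 2 + 4 * Real.exp (2 * K) * K ^ 3) := by positivity
        have h4 := mul_le_mul_of_nonneg_left h2 h3
        linarith
    _ = _ := by
        rw [Finset.sum_add_distrib, ← Finset.mul_sum, ← Finset.mul_sum, Finset.sum_range_sub,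
          grid_zero ht, grid_last]
        ring

variable [IsProbabilityMeasure P]

lemma tendsto_integral_sum_remainder (h : IsDiffusion ℱ P T K y₀ Y b q) (ht : 0 ≤ t)
    (htT : t ≤ T) :
    Tendsto (fun n : ℕ => ∫ ω, ∑ i ∈ Finset.range (n + 1),
      remainder Y b (grid t n i) (grid t n (i + 1)) ω ∂P) atTop (nhds 0) := by
  have hcont : ∀ᵐ ω ∂P, Tendsto (fun n => gridOsc Y t n ω) atTop (nhds 0) := by
    filter_upwards [h.cont] with ω hω
    exact tendsto_gridOsc ht (hω.mono (Icc_subset_Icc_right htT))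
  have hδ := fun n => h.bddMeas_gridOsc ht htT n
  have hS := fun n => (h.bddMeas_sum_incr_sq (grid_mono ht n)
    (fun i => ⟨(grid_mem ht n i).1, (grid_mem ht n i).2.trans htT⟩) (n + 1)).mono (ℱ.le _)
  have hlim : ∀ k : ℕ, k ≠ 0 →
      Tendsto (fun n => ∫ ω, gridOsc Y t n ω ^ k ∂P) atTop (nhds 0) := by
    intro k hk
    have := tendsto_integral_of_dominated_convergence (μ := P)
      (F := fun n ω => gridOsc Y t n ω ^ k) (f := fun _ => 0) (fun _ => (2 * K) ^ k)
      (fun n => ((hδ n).pow k).1) (integrable_const _)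
      (fun n => ae_of_all _ fun ω => by
        rw [Real.norm_eq_abs, abs_of_nonneg (pow_nonneg (gridOsc_nonneg n ω) k)]
        exact pow_le_pow_left₀ (gridOsc_nonneg n ω) (h.gridOsc_le n ω) k)
      (by
        filter_upwards [hcont] with ω hω
        simpa [hk] using hω.pow k)
    simpa using this
  have hmix := tendsto_integral_mul_zero hδ hS (fun n ω => gridOsc_nonneg n ω)
    (fun n ω => Finset.sum_nonneg fun i _ => sq_nonneg _)
    (fun n => (h.integral_sum_incr_sq_sq_le (grid_mono ht n)
      (fun i => ⟨(grid_mem ht n i).1, (grid_mem ht n i).2.trans htT⟩) (n + 1)).trans_eq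
      (by rw [grid_zero ht, grid_last])) (hlim 2 two_ne_zero)
  have hη : Tendsto (fun n : ℕ => t / ((n : ℝ) + 1)) atTop (nhds 0) :=
    tendsto_const_div_atTop_nhds_zero_nat t |>.comp (tendsto_add_atTop_nat 1) |>.congr
      fun n => by simp
  have h1 : Tendsto (fun n => ∫ ω, gridOsc Y t n ω ∂P) atTop (nhds 0) := by
    simpa using hlim 1 one_ne_zero
  refine squeeze_zero_norm (a := fun n : ℕ => Real.exp K * (K * t) * ∫ ω, gridOsc Y t n ω ∂P
        + 2 * Real.exp K * Real.exp (2 * K) * ∫ ω, (gridOsc Y t n ω *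
          ∑ i ∈ Finset.range (n + 1), incr Y b (grid t n i) (grid t n (i + 1)) ω ^ 2) ∂P
        + Real.exp K * (2 * K ^ 2 + 4 * Real.exp (2 * K) * K ^ 3) * t * (t / (n + 1))) ?_ ?_
  · intro n
    have e1 := ((hδ n).const_mul (Real.exp K * (K * t)))
    have e2 := ((hδ n).mul (hS n)).const_mul (2 * Real.exp K * Real.exp (2 * K))
    have e3 := BddMeas.const (m := mΩ) (P := P)
      (Real.exp K * (2 * K ^ 2 + 4 * Real.exp (2 * K) * K ^ 3) * t * (t / (n + 1)))
    rw [← integral_const_mul, ← integral_const_mul, ← integral_add e1.integrable e2.integrable]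
    refine le_trans ?_ (le_of_eq ((integral_add (e1.add e2).integrable e3.integrable).trans
      (by simp)))
    refine norm_integral_le_of_norm_le ((e1.add e2).add e3).integrable ?_
    filter_upwards [h.cont_drift] with ω hω
    exact h.abs_sum_remainder_le ht htT n hω
  · simpa using ((h1.const_mul (Real.exp K * (K * t))).add
      (hmix.const_mul (2 * Real.exp K * Real.exp (2 * K)))).add (hη.const_mul
        (Real.exp K * (2 * K ^ 2 + 4 * Real.exp (2 * K) * K ^ 3) * t))

/-- Itô's formula for the exponential, in expectation. -/
theorem integral_exp_eq (h : IsDiffusion ℱ P T K y₀ Y b q) (ht : 0 ≤ t) (htT : t ≤ T) :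
    AEStronglyMeasurable
      (fun ω => ∫ r in (0 : ℝ)..t, Real.exp (Y r ω) * (b r ω + q r ω / 2)) P ∧
    ∫ ω, (Real.exp (Y t ω) - Real.exp (Y 0 ω)) ∂P
      = ∫ ω, (∫ r in (0 : ℝ)..t, Real.exp (Y r ω) * (b r ω + q r ω / 2)) ∂P := by
  set G : ℕ → Ω → ℝ := fun n ω => ∑ i ∈ Finset.range (n + 1), Real.exp (Y (grid t n i) ω) *
    (((∫ r in (0 : ℝ)..grid t n (i + 1), b r ω) - ∫ r in (0 : ℝ)..grid t n i, b r ω)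
      + ((∫ r in (0 : ℝ)..grid t n (i + 1), q r ω) - ∫ r in (0 : ℝ)..grid t n i, q r ω) / 2)
    with hG
  have hmem : ∀ n i, grid t n i ∈ Icc 0 T := fun n i =>
    ⟨(grid_mem ht n i).1, (grid_mem ht n i).2.trans htT⟩
  have hY := fun n i => (h.bddMeas (hmem n i).1 (hmem n i).2).mono (ℱ.le _)
  have hB := fun n i => (h.bddMeas_integral_drift (hmem n i).1 (hmem n i).2).mono (ℱ.le _)
  have hQ := fun n i => (h.bddMeas_integral_bracket (hmem n i).1 (hmem n i).2).mono (ℱ.le _)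
  have hterm : ∀ n i, BddMeas mΩ P (fun ω => Real.exp (Y (grid t n i) ω) *
    (((∫ r in (0 : ℝ)..grid t n (i + 1), b r ω) - ∫ r in (0 : ℝ)..grid t n i, b r ω)
      + ((∫ r in (0 : ℝ)..grid t n (i + 1), q r ω) - ∫ r in (0 : ℝ)..grid t n i, q r ω) / 2)) := by
    intro n i
    have := (hY n i).exp.mul (((hB n (i + 1)).sub (hB n i)).add
      (((hQ n (i + 1)).sub (hQ n i)).const_mul (1 / 2)))
    convert this using 3
    ring
  have hGm : ∀ n, BddMeas mΩ P (G n) := fun n => BddMeas.sum _ fun i _ => hterm n i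
  have hGeq : ∀ᵐ ω ∂P, ∀ n, G n ω = ∑ i ∈ Finset.range (n + 1), Real.exp (Y (grid t n i) ω) *
      ∫ r in grid t n i..grid t n (i + 1), (b r ω + q r ω / 2) := by
    filter_upwards [h.cont_drift, h.cont_bracket] with ω hb hq n
    refine Finset.sum_congr rfl fun i _ => ?_
    have hm := grid_mono ht n i.le_succ
    rw [integral_sub_eq_of_continuousOn hb (hmem n i).1 hm (hmem n (i + 1)).2,
      integral_sub_eq_of_continuousOn hq (hmem n i).1 hm (hmem n (i + 1)).2,
      intervalIntegral.integral_add
        (intervalIntegrable_of_continuousOn hb (hmem n i).1 hm (hmem n (i + 1)).2)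
        ((intervalIntegrable_of_continuousOn hq (hmem n i).1 hm (hmem n (i + 1)).2).div_const 2),
      intervalIntegral.integral_div]
  have hlim : ∀ᵐ ω ∂P, Tendsto (fun n => G n ω) atTop
      (nhds (∫ r in (0 : ℝ)..t, Real.exp (Y r ω) * (b r ω + q r ω / 2))) := by
    filter_upwards [hGeq, h.cont, h.cont_drift, h.cont_bracket] with ω hω hY hb hq
    simp only [hω]
    have hs : Icc 0 t ⊆ Icc 0 T := Icc_subset_Icc_right htT
    exact tendsto_sum_grid_mul_integral ht
      (f := fun r => Real.exp (Y r ω)) (g := fun r => b r ω + q r ω / 2)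
      (Real.continuous_exp.comp_continuousOn (hY.mono hs))
      ((hb.mono hs).add ((hq.mono hs).div_const 2))
  have hbound : ∀ n, ∀ᵐ ω ∂P, ‖G n ω‖ ≤ Real.exp K * (K + K / 2) * t := by
    intro n
    filter_upwards [hGeq] with ω hω
    rw [hω n, Real.norm_eq_abs]
    have hK : 0 ≤ K := (abs_nonneg _).trans (h.bound 0 ω)
    calc _ ≤ ∑ i ∈ Finset.range (n + 1), Real.exp K * (K + K / 2)
          * (grid t n (i + 1) - grid t n i) := by
          refine (Finset.abs_sum_le_sum_abs _ _).trans (Finset.sum_le_sum fun i _ => ?_)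
          rw [abs_mul, mul_assoc, abs_of_pos (Real.exp_pos _)]
          refine mul_le_mul (Real.exp_le_exp.2 ((le_abs_self _).trans (h.bound _ ω))) ?_
            (abs_nonneg _) (Real.exp_pos _).le
          have := abs_integral_le (K := K + K / 2) (f := fun r ω => b r ω + q r ω / 2)
            (fun r ω => ?_) (grid t n i) (grid t n (i + 1)) ω
          · rwa [abs_of_nonneg (sub_nonneg.2 (grid_mono ht n i.le_succ))] at this
          · refine (abs_add_le _ _).trans (add_le_add (h.bound_drift r ω) ?_)
            rw [abs_div, abs_two]
            linarith [h.bound_bracket r ω]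
      _ = _ := by
          rw [← Finset.mul_sum, Finset.sum_range_sub, grid_zero ht, grid_last, sub_zero]
  have hmeas := aestronglyMeasurable_of_tendsto_ae atTop (fun n => (hGm n).1) hlim
  refine ⟨hmeas, ?_⟩
  have hGlim := tendsto_integral_of_dominated_convergence _ (fun n => (hGm n).1)
    (integrable_const _) hbound hlim
  have hR := h.tendsto_integral_sum_remainder ht htT
  refine tendsto_nhds_unique ?_ ((hGlim.add hR).trans_eq (by rw [add_zero]))
  refine tendsto_const_nhds.congr fun n => ?_
  have hRm : ∀ i ∈ Finset.range (n + 1), Integrable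
      (fun ω => remainder Y b (grid t n i) (grid t n (i + 1)) ω) P := fun i _ =>
    (h.bddMeas_remainder (hmem n i).1 (grid_mono ht n i.le_succ) (hmem n (i + 1)).2).integrable
  rw [integral_finsetSum _ hRm, hG, integral_finsetSum _ fun i _ => (hterm n i).integrable,
    ← Finset.sum_add_distrib]
  rw [Finset.sum_congr rfl fun i _ => (h.integral_exp_sub (hmem n i).1
    (grid_mono ht n i.le_succ) (hmem n (i + 1)).2).symm, ← integral_finsetSum]
  · congr 1 with ω
    rw [Finset.sum_range_sub (fun i => Real.exp (Y (grid t n i) ω)), grid_zero ht, grid_last]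
  · exact fun i _ => ((hY n (i + 1)).exp.sub (hY n i).exp).integrable

end IsDiffusion

/-- Smooth compactly supported functions. -/
structure IsTest {d : ℕ} (φ : EuclideanSpace ℝ (Fin d) → ℝ) : Prop where
  smooth : ContDiff ℝ (⊤ : ℕ∞) φ
  supp : HasCompactSupport φ

/-- The `i`-th partial derivative. -/
def pderiv {d : ℕ} (i : Fin d) (φ : EuclideanSpace ℝ (Fin d) → ℝ) (x : EuclideanSpace ℝ (Fin d)) :
    ℝ :=
  fderiv ℝ φ x (EuclideanSpace.single i 1)

lemma laplacian_eq_sum_pderiv {d : ℕ} (φ : EuclideanSpace ℝ (Fin d) → ℝ) :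
    laplacian φ = fun x => ∑ i, pderiv i (pderiv i φ) x := rfl

lemma gradSq_eq_sum_pderiv {d : ℕ} (φ : EuclideanSpace ℝ (Fin d) → ℝ) :
    gradSq φ = fun x => ∑ i, pderiv i φ x ^ 2 := by
  funext x
  rw [gradSq, EuclideanSpace.norm_sq_eq]
  refine Finset.sum_congr rfl fun i _ => ?_
  have h1 : gradient φ x i = inner ℝ (EuclideanSpace.single i (1 : ℝ)) (gradient φ x) := by
    rw [EuclideanSpace.inner_single_left]; simp
  rw [h1, real_inner_comm, gradient, InnerProductSpace.toDual_symm_apply, Real.norm_eq_abs, sq_abs,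
    pderiv]

namespace IsTest

variable {d : ℕ} {φ ψ : EuclideanSpace ℝ (Fin d) → ℝ}

lemma continuous (h : IsTest φ) : Continuous φ := h.smooth.continuous

lemma differentiable (h : IsTest φ) : Differentiable ℝ φ := h.smooth.differentiable (by simp)

lemma exists_bound (h : IsTest φ) : ∃ C, ∀ x, |φ x| ≤ C :=
  h.continuous.bounded_above_of_compact_support h.supp

lemma add (h : IsTest φ) (h' : IsTest ψ) : IsTest (fun x => φ x + ψ x) :=
  ⟨h.smooth.add h'.smooth, h.supp.add h'.supp⟩

lemma mul_left (h : IsTest φ) {g : EuclideanSpace ℝ (Fin d) → ℝ} (hg : ContDiff ℝ (⊤ : ℕ∞) g) :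
    IsTest (fun x => g x * φ x) :=
  ⟨hg.mul h.smooth, h.supp.mul_left⟩

lemma sub (h : IsTest φ) (h' : IsTest ψ) : IsTest (fun x => φ x - ψ x) := by
  simpa [sub_eq_add_neg] using h.add (h'.mul_left (contDiff_const (c := (-1 : ℝ))))

lemma sum {ι : Type*} (s : Finset ι) {F : ι → EuclideanSpace ℝ (Fin d) → ℝ}
    (hF : ∀ i ∈ s, IsTest (F i)) : IsTest (fun x => ∑ i ∈ s, F i x) := by
  classical
  induction s using Finset.induction_on with
  | empty => exact ⟨by simpa using contDiff_const, by
    simp only [Finset.sum_empty]; exact HasCompactSupport.zero⟩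
  | insert a s ha ih =>
    simp only [Finset.sum_insert ha]
    exact (hF a (by simp)).add (ih fun i hi => hF i (by simp [hi]))

lemma pderiv (h : IsTest φ) (i : Fin d) : IsTest (pderiv i φ) :=
  ⟨(h.smooth.fderiv_right (m := (⊤ : ℕ∞)) (by simp)).clm_apply contDiff_const,
    h.supp.fderiv_apply ℝ _⟩

lemma laplacian (h : IsTest φ) : IsTest (laplacian φ) :=
  sum _ fun i _ => (h.pderiv i).pderiv i

lemma gradSq (h : IsTest φ) : IsTest (gradSq φ) := by
  rw [gradSq_eq_sum_pderiv]
  refine sum _ fun i _ => ?_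
  simp only [pow_two]
  exact (h.pderiv i).mul_left (h.pderiv i).smooth

end IsTest

lemma pderiv_add {d : ℕ} {φ ψ : EuclideanSpace ℝ (Fin d) → ℝ} (i : Fin d) (h : IsTest φ)
    (h' : IsTest ψ) (x : EuclideanSpace ℝ (Fin d)) :
    pderiv i (fun x => φ x + ψ x) x = pderiv i φ x + pderiv i ψ x := by
  simp [pderiv, fderiv_fun_add h.differentiable.differentiableAt h'.differentiable.differentiableAt]

lemma pderiv_sub {d : ℕ} {φ ψ : EuclideanSpace ℝ (Fin d) → ℝ} (i : Fin d) (h : IsTest φ)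
    (h' : IsTest ψ) (x : EuclideanSpace ℝ (Fin d)) :
    pderiv i (fun x => φ x - ψ x) x = pderiv i φ x - pderiv i ψ x := by
  simp [pderiv, fderiv_fun_sub h.differentiable.differentiableAt h'.differentiable.differentiableAt]

/-- A partial derivative is a difference of squared gradient norms. -/
lemma IsTest.exists_pderiv_eq_gradSq_sub {d : ℕ} {φ : EuclideanSpace ℝ (Fin d) → ℝ} (h : IsTest φ)
    (i : Fin d) : ∃ ψ₁ ψ₂ : EuclideanSpace ℝ (Fin d) → ℝ, IsTest ψ₁ ∧ IsTest ψ₂ ∧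
      ∀ x, _root_.pderiv i φ x = (1 / 4) * _root_.gradSq ψ₁ x
        + (-1 / 4) * _root_.gradSq ψ₂ x := by
  obtain ⟨R, hR0, hR⟩ := h.supp.isCompact.isBounded.subset_ball_lt 0 0
  let χ : ContDiffBump (0 : EuclideanSpace ℝ (Fin d)) := ⟨R, R + 1, hR0, by linarith⟩
  have hχ : IsTest (fun x => x i * χ x) :=
    IsTest.mul_left ⟨χ.contDiff, χ.hasCompactSupport⟩ (EuclideanSpace.proj (𝕜 := ℝ) i).contDiff
  refine ⟨_, _, h.add hχ, h.sub hχ, fun x => ?_⟩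
  simp only [gradSq_eq_sum_pderiv, pderiv_add _ h hχ, pderiv_sub _ h hχ]
  rw [Finset.mul_sum, Finset.mul_sum, ← Finset.sum_add_distrib]
  have : ∀ j, _root_.pderiv j φ x * _root_.pderiv j (fun x => x i * χ x) x
      = if j = i then _root_.pderiv i φ x else 0 := by
    intro j
    by_cases hx : x ∈ tsupport φ
    · have heq : (fun x : EuclideanSpace ℝ (Fin d) => x i * χ x) =ᶠ[nhds x]
          EuclideanSpace.proj (𝕜 := ℝ) i := by
        filter_upwards [Metric.isOpen_ball.mem_nhds (hR hx)] with y hy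
        rw [χ.one_of_mem_closedBall (Metric.ball_subset_closedBall hy)]
        simp
      have hd : _root_.pderiv j (fun x => x i * χ x) x = if j = i then 1 else 0 := by
        rw [_root_.pderiv, heq.fderiv_eq, ContinuousLinearMap.fderiv]
        simp [eq_comm]
      rw [hd]
      split_ifs with hji
      · rw [hji, mul_one]
      · rw [mul_zero]
    · have h0 : ∀ j, _root_.pderiv j φ x = 0 := fun j => by
        rw [_root_.pderiv, fderiv_of_notMem_tsupport (𝕜 := ℝ) hx]; simp
      simp [h0]
  calc _root_.pderiv i φ x = ∑ j, if j = i then _root_.pderiv i φ x else 0 := by simp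
    _ = _ := Finset.sum_congr rfl fun j _ => by rw [← this j]; ring

section Pairing

variable {d : ℕ} {f g : EuclideanSpace ℝ (Fin d) → ℝ}
  {ν : ProbabilityMeasure (EuclideanSpace ℝ (Fin d))} {C : ℝ}

lemma continuous_pairing (hf : Continuous f) (hC : ∀ x, |f x| ≤ C) :
    Continuous fun ν : ProbabilityMeasure (EuclideanSpace ℝ (Fin d)) => pairing ν f :=
  ProbabilityMeasure.continuous_integral_boundedContinuousFunction
    (BoundedContinuousFunction.ofNormedAddCommGroup f hf C hC)

lemma integrable_of_measurable_of_abs_le (hf : Measurable f) (hC : ∀ x, |f x| ≤ C) :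
    Integrable f (ν : Measure (EuclideanSpace ℝ (Fin d))) :=
  Integrable.of_bound hf.aestronglyMeasurable C (ae_of_all _ hC)

lemma abs_pairing_le (hC : ∀ x, |f x| ≤ C) : |pairing ν f| ≤ C := by
  simpa [pairing] using norm_integral_le_of_norm_le_const
    (μ := (ν : Measure (EuclideanSpace ℝ (Fin d)))) (f := f) (C := C) (ae_of_all _ hC)

lemma IsTest.integrable (hf : IsTest f) :
    Integrable f (ν : Measure (EuclideanSpace ℝ (Fin d))) :=
  integrable_of_measurable_of_abs_le hf.continuous.measurable hf.exists_bound.choose_spec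

end Pairing

namespace IsMPSolution

variable {d : ℕ} {T α : ℝ} {Ω : Type*} {mΩ : MeasurableSpace Ω} {P : Measure Ω}
  {ℱ : Filtration ℝ mΩ} {μ0 : ProbabilityMeasure (EuclideanSpace ℝ (Fin d))}
  {μ : ℝ → Ω → ProbabilityMeasure (EuclideanSpace ℝ (Fin d))}
  {φ : EuclideanSpace ℝ (Fin d) → ℝ} {t : ℝ}

lemma continuousOn_pairing (h : IsMPSolution d T α ℱ P μ0 μ) :
    ∀ᵐ ω ∂P, ∀ f : EuclideanSpace ℝ (Fin d) → ℝ, Continuous f → ∀ C, (∀ x, |f x| ≤ C) →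
      ContinuousOn (fun t => pairing (μ t ω) f) (Icc 0 T) := by
  filter_upwards [h.cont] with ω hω f hf C hC
  exact (continuous_pairing hf hC).comp_continuousOn hω

lemma ae_continuousOn_pairing_isTest (h : IsMPSolution d T α ℱ P μ0 μ) (hφ : IsTest φ) :
    ∀ᵐ ω ∂P, ContinuousOn (fun t => pairing (μ t ω) φ) (Icc 0 T) := by
  obtain ⟨C, hC⟩ := hφ.exists_bound
  filter_upwards [h.continuousOn_pairing] with ω hω
  exact hω φ hφ.continuous C hC

lemma stronglyMeasurable_integral_gradSq (h : IsMPSolution d T α ℱ P μ0 μ) (hφ : IsTest φ)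
    (ht : 0 ≤ t) (htT : t ≤ T) :
    StronglyMeasurable[ℱ t] (fun ω => ∫ s in (0 : ℝ)..t, pairing (μ s ω) (gradSq φ)) := by
  have h1 := (h.mart φ hφ.smooth hφ.supp).1 t ht htT
  have h2 := (h.qvar φ hφ.smooth hφ.supp).1 t ht htT
  convert (h1.pow 2).sub h2 using 2 with ω
  simp

lemma aestronglyMeasurable_integral_pderiv (h : IsMPSolution d T α ℱ P μ0 μ) (hφ : IsTest φ)
    (i : Fin d) (ht : 0 ≤ t) (htT : t ≤ T) :
    AEStronglyMeasurable[ℱ t] (fun ω => ∫ s in (0 : ℝ)..t, pairing (μ s ω) (pderiv i φ)) P := by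
  obtain ⟨ψ₁, ψ₂, h₁, h₂, heq⟩ := hφ.exists_pderiv_eq_gradSq_sub i
  have hm := ((h.stronglyMeasurable_integral_gradSq h₁ ht htT).const_mul (1 / 4)).add
    ((h.stronglyMeasurable_integral_gradSq h₂ ht htT).const_mul (-1 / 4))
  refine hm.aestronglyMeasurable.congr ?_
  filter_upwards [h.ae_continuousOn_pairing_isTest h₁.gradSq,
    h.ae_continuousOn_pairing_isTest h₂.gradSq] with ω hc₁ hc₂
  simp only [Pi.add_apply]
  rw [← intervalIntegral.integral_const_mul, ← intervalIntegral.integral_const_mul,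
    ← intervalIntegral.integral_add
      ((IsDiffusion.intervalIntegrable_of_continuousOn hc₁ le_rfl ht htT).const_mul _)
      ((IsDiffusion.intervalIntegrable_of_continuousOn hc₂ le_rfl ht htT).const_mul _)]
  congr 1 with s
  simp only [pairing, heq]
  rw [integral_add (h₁.gradSq.integrable.const_mul _) (h₂.gradSq.integrable.const_mul _),
    integral_const_mul, integral_const_mul]

lemma aestronglyMeasurable_integral_laplacian (h : IsMPSolution d T α ℱ P μ0 μ) (hφ : IsTest φ)
    (ht : 0 ≤ t) (htT : t ≤ T) :
    AEStronglyMeasurable[ℱ t] (fun ω => ∫ s in (0 : ℝ)..t, pairing (μ s ω) (laplacian φ)) P := by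
  have hm : BddMeas (ℱ t) P (fun ω => ∑ i, ∫ s in (0 : ℝ)..t,
      pairing (μ s ω) (pderiv i (pderiv i φ))) := by
    refine BddMeas.sum _ fun i _ =>
      ⟨h.aestronglyMeasurable_integral_pderiv (hφ.pderiv i) i ht htT, ?_⟩
    obtain ⟨C, hC⟩ := ((hφ.pderiv i).pderiv i).exists_bound
    exact ⟨_, IsDiffusion.abs_integral_le (fun s ω => abs_pairing_le hC) 0 t⟩
  refine hm.1.congr ?_
  have hc : ∀ᵐ ω ∂P, ∀ i, ContinuousOn
      (fun t => pairing (μ t ω) (pderiv i (pderiv i φ))) (Icc 0 T) :=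
    ae_all_iff.2 fun i => h.ae_continuousOn_pairing_isTest ((hφ.pderiv i).pderiv i)
  filter_upwards [hc] with ω hω
  rw [← intervalIntegral.integral_finsetSum fun i _ =>
    IsDiffusion.intervalIntegrable_of_continuousOn (hω i) le_rfl ht htT]
  congr 1 with s
  simp only [pairing, laplacian_eq_sum_pderiv]
  rw [integral_finsetSum _ fun i _ => ((hφ.pderiv i).pderiv i).integrable]

lemma aestronglyMeasurable_pairing (h : IsMPSolution d T α ℱ P μ0 μ) (hφ : IsTest φ)
    (ht : 0 ≤ t) (htT : t ≤ T) :
    AEStronglyMeasurable[ℱ t] (fun ω => pairing (μ t ω) φ) P := by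
  have h1 := ((h.mart φ hφ.smooth hφ.supp).1 t ht htT).aestronglyMeasurable (μ := P)
  have h2 := (h.aestronglyMeasurable_integral_laplacian hφ ht htT).const_mul (α / 2)
  refine ((h1.add (aestronglyMeasurable_const (b := pairing μ0 φ))).add h2).congr
    (ae_of_all _ fun ω => ?_)
  simp only [Pi.add_apply]
  ring

lemma exists_isDiffusion (h : IsMPSolution d T α ℱ P μ0 μ) (hφ : IsTest φ) :
    ∃ K, IsDiffusion ℱ P T K (pairing μ0 φ) (fun t ω => pairing (μ t ω) φ)
      (fun t ω => (α / 2) * pairing (μ t ω) (laplacian φ))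
      (fun t ω => pairing (μ t ω) (gradSq φ)) := by
  obtain ⟨C₁, hC₁⟩ := hφ.exists_bound
  obtain ⟨C₂, hC₂⟩ := hφ.laplacian.exists_bound
  obtain ⟨C₃, hC₃⟩ := hφ.gradSq.exists_bound
  refine ⟨max C₁ (max (|α / 2| * C₂) C₃), ?_, h.ae_continuousOn_pairing_isTest hφ, ?_,
    h.ae_continuousOn_pairing_isTest hφ.gradSq, ?_, ?_, ?_, ?_, ?_⟩
  · exact fun t ht htT => h.aestronglyMeasurable_pairing hφ ht htT
  · filter_upwards [h.ae_continuousOn_pairing_isTest hφ.laplacian] with ω hω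
    exact hω.const_mul _
  · exact fun t ω => (abs_pairing_le hC₁).trans (le_max_left _ _)
  · intro t ω
    rw [abs_mul]
    exact (mul_le_mul_of_nonneg_left (abs_pairing_le hC₂) (abs_nonneg _)).trans
      ((le_max_left _ _).trans (le_max_right _ _))
  · exact fun t ω => (abs_pairing_le hC₃).trans ((le_max_right _ _).trans (le_max_right _ _))
  · simpa only [intervalIntegral.integral_const_mul] using h.mart φ hφ.smooth hφ.supp
  · simpa only [intervalIntegral.integral_const_mul] using h.qvar φ hφ.smooth hφ.supp

end IsMPSolution

section ExpLog

variable {d : ℕ} {α c : ℝ} {g ℓ : EuclideanSpace ℝ (Fin d) → ℝ}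

/-- The exponential functional `exp ⟨ν, α log (1 - c g)⟩`. -/
def expLog (α c : ℝ) (g : EuclideanSpace ℝ (Fin d) → ℝ)
    (ν : ProbabilityMeasure (EuclideanSpace ℝ (Fin d))) : ℝ :=
  Real.exp (pairing ν fun x => α * Real.log (1 - c * g x))

/-- The generator of the martingale problem applied to `expLog α c g`, for `ℓ = Δ g`. -/
def expLogGen (α c : ℝ) (g ℓ : EuclideanSpace ℝ (Fin d) → ℝ)
    (ν : ProbabilityMeasure (EuclideanSpace ℝ (Fin d))) : ℝ :=
  expLog α c g ν * pairing ν fun x => -(c * α ^ 2 / 2) * (ℓ x / (1 - c * g x))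

lemma one_sub_mul_ge (hc : 0 ≤ c) (hg : ∀ x, g x ∈ Icc (0 : ℝ) 1)
    (x : EuclideanSpace ℝ (Fin d)) : 1 - c ≤ 1 - c * g x := by
  nlinarith [(hg x).2]

lemma one_sub_mul_pos (hc : c ∈ Ico (0 : ℝ) 1) (hg : ∀ x, g x ∈ Icc (0 : ℝ) 1)
    (x : EuclideanSpace ℝ (Fin d)) : 0 < 1 - c * g x :=
  (sub_pos.2 hc.2).trans_le (one_sub_mul_ge hc.1 hg x)

lemma abs_mul_log_le (hc : c ∈ Ico (0 : ℝ) 1) (hg : ∀ x, g x ∈ Icc (0 : ℝ) 1)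
    (x : EuclideanSpace ℝ (Fin d)) :
    |α * Real.log (1 - c * g x)| ≤ |α| * -Real.log (1 - c) := by
  rw [abs_mul]
  refine mul_le_mul_of_nonneg_left ?_ (abs_nonneg _)
  have h1 := one_sub_mul_pos hc hg x
  have h2 : 1 - c * g x ≤ 1 := by nlinarith [(hg x).1, hc.1]
  rw [abs_of_nonpos (Real.log_nonpos h1.le h2), neg_le_neg_iff]
  exact Real.log_le_log (sub_pos.2 hc.2) (one_sub_mul_ge hc.1 hg x)

lemma abs_mul_div_le (hc : c ∈ Ico (0 : ℝ) 1) (hg : ∀ x, g x ∈ Icc (0 : ℝ) 1) {C : ℝ}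
    (hℓ : ∀ x, |ℓ x| ≤ C) (x : EuclideanSpace ℝ (Fin d)) :
    |-(c * α ^ 2 / 2) * (ℓ x / (1 - c * g x))| ≤ |-(c * α ^ 2 / 2)| * (C / (1 - c)) := by
  rw [abs_mul, abs_div, abs_of_pos (one_sub_mul_pos hc hg x)]
  refine mul_le_mul_of_nonneg_left ?_ (abs_nonneg _)
  exact div_le_div₀ ((abs_nonneg _).trans (hℓ x)) (hℓ x) (sub_pos.2 hc.2)
    (one_sub_mul_ge hc.1 hg x)

lemma expLog_pos (ν : ProbabilityMeasure (EuclideanSpace ℝ (Fin d))) : 0 < expLog α c g ν :=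
  Real.exp_pos _

lemma expLog_le (hc : c ∈ Ico (0 : ℝ) 1) (hg : ∀ x, g x ∈ Icc (0 : ℝ) 1)
    (ν : ProbabilityMeasure (EuclideanSpace ℝ (Fin d))) :
    expLog α c g ν ≤ Real.exp (|α| * -Real.log (1 - c)) :=
  Real.exp_le_exp.2 ((le_abs_self _).trans (abs_pairing_le (abs_mul_log_le hc hg)))

lemma abs_expLogGen_le (hc : c ∈ Ico (0 : ℝ) 1) (hg : ∀ x, g x ∈ Icc (0 : ℝ) 1) {C : ℝ}
    (hℓ : ∀ x, |ℓ x| ≤ C) (ν : ProbabilityMeasure (EuclideanSpace ℝ (Fin d))) :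
    |expLogGen α c g ℓ ν| ≤ Real.exp (|α| * -Real.log (1 - c))
      * (|-(c * α ^ 2 / 2)| * (C / (1 - c))) := by
  rw [expLogGen, abs_mul, abs_of_pos (expLog_pos ν)]
  exact mul_le_mul (expLog_le hc hg ν) (abs_pairing_le (abs_mul_div_le hc hg hℓ))
    (abs_nonneg _) (Real.exp_pos _).le

lemma continuous_expLog (hc : c ∈ Ico (0 : ℝ) 1) (hg : ∀ x, g x ∈ Icc (0 : ℝ) 1)
    (hgc : Continuous g) : Continuous (expLog α c g) := by
  refine Real.continuous_exp.comp (continuous_pairing ?_ (abs_mul_log_le hc hg))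
  exact continuous_const.mul ((by fun_prop : Continuous fun x => 1 - c * g x).log
    fun x => (one_sub_mul_pos hc hg x).ne')

lemma continuous_expLogGen (hc : c ∈ Ico (0 : ℝ) 1) (hg : ∀ x, g x ∈ Icc (0 : ℝ) 1)
    (hgc : Continuous g) (hℓc : Continuous ℓ) {C : ℝ} (hℓ : ∀ x, |ℓ x| ≤ C) :
    Continuous (expLogGen α c g ℓ) := by
  refine (continuous_expLog hc hg hgc).mul (continuous_pairing ?_ (abs_mul_div_le hc hg hℓ))
  exact continuous_const.mul (hℓc.div (by fun_prop) fun x => (one_sub_mul_pos hc hg x).ne')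

lemma tendsto_expLog (hc : c ∈ Ico (0 : ℝ) 1) {G : ℕ → EuclideanSpace ℝ (Fin d) → ℝ}
    (hG : ∀ n x, G n x ∈ Icc (0 : ℝ) 1) (hGm : ∀ n, Measurable (G n))
    (hg : ∀ x, g x ∈ Icc (0 : ℝ) 1) (hlim : ∀ x, Tendsto (fun n => G n x) atTop (nhds (g x)))
    (ν : ProbabilityMeasure (EuclideanSpace ℝ (Fin d))) :
    Tendsto (fun n => expLog α c (G n) ν) atTop (nhds (expLog α c g ν)) := by
  refine (Real.continuous_exp.tendsto _).comp ?_
  refine tendsto_integral_of_dominated_convergence (fun _ => |α| * -Real.log (1 - c))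
    (fun n => ?_) (integrable_const _) (fun n => ae_of_all _ (abs_mul_log_le hc (hG n)))
    (ae_of_all _ fun x => ?_)
  · exact (((hGm n).const_mul c).const_sub 1).log.const_mul α |>.aestronglyMeasurable
  · exact ((((hlim x).const_mul c).const_sub 1).log (one_sub_mul_pos hc hg x).ne').const_mul α

lemma tendsto_expLogGen (hc : c ∈ Ico (0 : ℝ) 1) {G L : ℕ → EuclideanSpace ℝ (Fin d) → ℝ}
    (hG : ∀ n x, G n x ∈ Icc (0 : ℝ) 1) (hGm : ∀ n, Measurable (G n))
    (hg : ∀ x, g x ∈ Icc (0 : ℝ) 1) (hlim : ∀ x, Tendsto (fun n => G n x) atTop (nhds (g x)))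
    (hLm : ∀ n, Measurable (L n)) {C : ℝ} (hL : ∀ n x, |L n x| ≤ C)
    (hlimL : ∀ x, Tendsto (fun n => L n x) atTop (nhds (ℓ x)))
    (ν : ProbabilityMeasure (EuclideanSpace ℝ (Fin d))) :
    Tendsto (fun n => expLogGen α c (G n) (L n) ν) atTop (nhds (expLogGen α c g ℓ ν)) := by
  refine (tendsto_expLog hc hG hGm hg hlim ν).mul ?_
  refine tendsto_integral_of_dominated_convergence
    (fun _ => |-(c * α ^ 2 / 2)| * (C / (1 - c))) (fun n => ?_) (integrable_const _)
    (fun n => ae_of_all _ (abs_mul_div_le hc (hG n) (hL n))) (ae_of_all _ fun x => ?_)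
  · exact ((hLm n).div (((hGm n).const_mul c).const_sub 1)).const_mul _ |>.aestronglyMeasurable
  · exact ((hlimL x).div (((hlim x).const_mul c).const_sub 1)
      (one_sub_mul_pos hc hg x).ne').const_mul _

lemma isTest_mul_log (α : ℝ) (hc : c ∈ Ico (0 : ℝ) 1) (hg : ∀ x, g x ∈ Icc (0 : ℝ) 1)
    (hgt : IsTest g) : IsTest (fun x => α * Real.log (1 - c * g x)) := by
  refine ⟨contDiff_const.mul ((contDiff_const.sub (contDiff_const.mul hgt.smooth)).log
    fun x => (one_sub_mul_pos hc hg x).ne'), ?_⟩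
  exact hgt.supp.comp_left (g := fun y : ℝ => α * Real.log (1 - c * y)) (by simp)

lemma half_laplacian_add_half_gradSq_mul_log (hc : c ∈ Ico (0 : ℝ) 1)
    (hg : ∀ x, g x ∈ Icc (0 : ℝ) 1) (hgt : IsTest g) (x : EuclideanSpace ℝ (Fin d)) :
    (α / 2) * laplacian (fun x => α * Real.log (1 - c * g x)) x
      + (1 / 2) * gradSq (fun x => α * Real.log (1 - c * g x)) x
      = -(c * α ^ 2 / 2) * (laplacian g x / (1 - c * g x)) := by
  have hpos := one_sub_mul_pos hc hg
  have hgd : ∀ x, HasFDerivAt g (fderiv ℝ g x) x := fun x =>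
    hgt.differentiable.differentiableAt.hasFDerivAt
  have hin : ∀ x, HasFDerivAt (fun x => 1 - c * g x) (-(c • fderiv ℝ g x)) x := fun x =>
    ((hgd x).const_mul c).const_sub 1
  have h1 : ∀ i, pderiv i (fun x => α * Real.log (1 - c * g x))
      = fun x => -(α * c) * (pderiv i g x * (1 - c * g x)⁻¹) := by
    intro i
    funext x
    rw [pderiv, (((hin x).log (hpos x).ne').const_mul α).fderiv]
    simp [pderiv]
    ring
  have h2 : ∀ i x, pderiv i (fun x => -(α * c) * (pderiv i g x * (1 - c * g x)⁻¹)) x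
      = -(α * c) * (pderiv i (pderiv i g) x / (1 - c * g x)
        + c * pderiv i g x ^ 2 / (1 - c * g x) ^ 2) := by
    intro i x
    have hp : HasFDerivAt (pderiv i g) (fderiv ℝ (pderiv i g) x) x :=
      (hgt.pderiv i).differentiable.differentiableAt.hasFDerivAt
    have hinv := (hasDerivAt_inv (hpos x).ne').comp_hasFDerivAt x (hin x)
    have := ((hp.mul hinv).const_mul (-(α * c))).fderiv
    rw [pderiv]
    erw [this]
    have hne := (hpos x).ne'
    simp [pderiv]
    field_simp
    ring
  rw [laplacian_eq_sum_pderiv, gradSq_eq_sum_pderiv, laplacian_eq_sum_pderiv]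
  simp only [h1, h2]
  rw [Finset.mul_sum, Finset.mul_sum, ← Finset.sum_add_distrib, Finset.sum_div, Finset.mul_sum]
  refine Finset.sum_congr rfl fun i _ => ?_
  have hne := (hpos x).ne'
  field_simp
  ring

end ExpLog

section Dynkin

variable {d : ℕ} {T α c : ℝ} {Ω : Type*} {mΩ : MeasurableSpace Ω} {P : Measure Ω}
  {ℱ : Filtration ℝ mΩ} {μ0 : ProbabilityMeasure (EuclideanSpace ℝ (Fin d))}
  {μ : ℝ → Ω → ProbabilityMeasure (EuclideanSpace ℝ (Fin d))}
  {g ℓ : EuclideanSpace ℝ (Fin d) → ℝ}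

/-- Dynkin's formula for the functional `expLog α c g`, with `ℓ` in the role of `Δ g`. -/
structure DynkinFormula (P : Measure Ω) (μ : ℝ → Ω → ProbabilityMeasure (EuclideanSpace ℝ (Fin d)))
    (T α c : ℝ) (g ℓ : EuclideanSpace ℝ (Fin d) → ℝ) : Prop where
  meas : ∀ t ∈ Icc 0 T, AEStronglyMeasurable (fun ω => expLog α c g (μ t ω)) P
  meas_integral : ∀ t ∈ Icc 0 T,
    AEStronglyMeasurable (fun ω => ∫ r in (0 : ℝ)..t, expLogGen α c g ℓ (μ r ω)) P
  formula : ∀ t ∈ Icc 0 T, ∫ ω, (expLog α c g (μ t ω) - expLog α c g (μ 0 ω)) ∂P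
    = ∫ ω, (∫ r in (0 : ℝ)..t, expLogGen α c g ℓ (μ r ω)) ∂P

variable [IsProbabilityMeasure P]

lemma IsMPSolution.dynkinFormula_isTest (h : IsMPSolution d T α ℱ P μ0 μ)
    (hc : c ∈ Ico (0 : ℝ) 1) (hg : ∀ x, g x ∈ Icc (0 : ℝ) 1) (hgt : IsTest g) :
    DynkinFormula P μ T α c g (laplacian g) := by
  have hφ := isTest_mul_log α hc hg hgt
  obtain ⟨K, hK⟩ := h.exists_isDiffusion hφ
  have heq : ∀ r ω, Real.exp (pairing (μ r ω) fun x => α * Real.log (1 - c * g x)) *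
      (α / 2 * pairing (μ r ω) (laplacian fun x => α * Real.log (1 - c * g x))
        + pairing (μ r ω) (gradSq fun x => α * Real.log (1 - c * g x)) / 2)
      = expLogGen α c g (laplacian g) (μ r ω) := by
    intro r ω
    rw [expLogGen, expLog]
    congr 1
    simp only [pairing]
    rw [div_eq_mul_one_div (∫ x, gradSq _ x ∂_), mul_comm _ (1 / 2 : ℝ), ← integral_const_mul, ← integral_const_mul,
      ← integral_add (hφ.laplacian.integrable.const_mul _) (hφ.gradSq.integrable.const_mul _)]
    congr 1 with x
    exact half_laplacian_add_half_gradSq_mul_log hc hg hgt x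
  refine ⟨fun t ht => ?_, fun t ht => ?_, fun t ht => ?_⟩
  · exact ((hK.bddMeas ht.1 ht.2).exp.mono (ℱ.le _)).1
  · have := (hK.integral_exp_eq ht.1 ht.2).1
    simpa only [heq] using this
  · have := (hK.integral_exp_eq ht.1 ht.2).2
    simp only [heq] at this
    exact this

lemma IsMPSolution.dynkinFormula_of_tendsto (h : IsMPSolution d T α ℱ P μ0 μ)
    (hc : c ∈ Ico (0 : ℝ) 1) {G L : ℕ → EuclideanSpace ℝ (Fin d) → ℝ}
    (hGL : ∀ n, DynkinFormula P μ T α c (G n) (L n))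
    (hG : ∀ n x, G n x ∈ Icc (0 : ℝ) 1) (hGc : ∀ n, Continuous (G n))
    (hlim : ∀ x, Tendsto (fun n => G n x) atTop (nhds (g x)))
    (hLc : ∀ n, Continuous (L n)) {C : ℝ} (hL : ∀ n x, |L n x| ≤ C)
    (hlimL : ∀ x, Tendsto (fun n => L n x) atTop (nhds (ℓ x))) :
    DynkinFormula P μ T α c g ℓ := by
  have hg : ∀ x, g x ∈ Icc (0 : ℝ) 1 := fun x =>
    isClosed_Icc.mem_of_tendsto (hlim x) (Eventually.of_forall fun n => hG n x)
  have h1 := tendsto_expLog (α := α) hc hG (fun n => (hGc n).measurable) hg hlim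
  have h2 := tendsto_expLogGen (α := α) hc hG (fun n => (hGc n).measurable) hg hlim
    (fun n => (hLc n).measurable) hL hlimL
  set B := Real.exp (|α| * -Real.log (1 - c)) with hB
  set D := B * (|-(c * α ^ 2 / 2)| * (C / (1 - c))) with hD
  have hb1 : ∀ n ν, |expLog α c (G n) ν| ≤ B := fun n ν => by
    rw [abs_of_pos (expLog_pos ν)]; exact expLog_le hc (hG n) ν
  have hb2 : ∀ n ν, |expLogGen α c (G n) (L n) ν| ≤ D := fun n ν =>
    abs_expLogGen_le hc (hG n) (hL n) ν
  have hm : ∀ t ∈ Icc 0 T, AEStronglyMeasurable (fun ω => expLog α c g (μ t ω)) P := fun t ht =>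
    aestronglyMeasurable_of_tendsto_ae atTop (fun n => (hGL n).meas t ht)
      (ae_of_all _ fun ω => h1 (μ t ω))
  have hint : ∀ t ∈ Icc 0 T, ∀ᵐ ω ∂P, Tendsto
      (fun n => ∫ r in (0 : ℝ)..t, expLogGen α c (G n) (L n) (μ r ω)) atTop
      (nhds (∫ r in (0 : ℝ)..t, expLogGen α c g ℓ (μ r ω))) := by
    intro t ht
    filter_upwards [h.cont] with ω hω
    refine intervalIntegral.tendsto_integral_filter_of_dominated_convergence (fun _ => D)
      (Eventually.of_forall fun n => ?_) (Eventually.of_forall fun n => ae_of_all _ fun r _ =>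
        hb2 n (μ r ω)) intervalIntegrable_const (ae_of_all _ fun r _ => h2 (μ r ω))
    rw [uIoc_of_le ht.1]
    refine ((continuous_expLogGen hc (hG n) (hGc n) (hLc n) (hL n)).comp_continuousOn
      (hω.mono (Ioc_subset_Icc_self.trans (Icc_subset_Icc_right ht.2)))).aestronglyMeasurable
      measurableSet_Ioc
  have hmi : ∀ t ∈ Icc 0 T, AEStronglyMeasurable
      (fun ω => ∫ r in (0 : ℝ)..t, expLogGen α c g ℓ (μ r ω)) P := fun t ht =>
    aestronglyMeasurable_of_tendsto_ae atTop (fun n => (hGL n).meas_integral t ht) (hint t ht)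
  refine ⟨hm, hmi, fun t ht => ?_⟩
  have h0 : (0 : ℝ) ∈ Icc 0 T := ⟨le_rfl, ht.1.trans ht.2⟩
  have l1 := tendsto_integral_of_dominated_convergence (μ := P)
    (F := fun n ω => expLog α c (G n) (μ t ω) - expLog α c (G n) (μ 0 ω)) (fun _ => B + B)
    (fun n => ((hGL n).meas t ht).sub ((hGL n).meas 0 h0)) (integrable_const _)
    (fun n => ae_of_all _ fun ω => (norm_sub_le _ _).trans (add_le_add (hb1 n _) (hb1 n _)))
    (ae_of_all _ fun ω => (h1 (μ t ω)).sub (h1 (μ 0 ω)))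
  have l2 := tendsto_integral_of_dominated_convergence (μ := P) (fun _ => D * |t - 0|)
    (fun n => (hGL n).meas_integral t ht) (integrable_const _)
    (fun n => ae_of_all _ fun ω => IsDiffusion.abs_integral_le
      (f := fun r ω => expLogGen α c (G n) (L n) (μ r ω)) (fun r ω => hb2 n (μ r ω)) 0 t ω)
    (hint t ht)
  exact tendsto_nhds_unique (l1.congr fun n => (hGL n).formula t ht) l2

end Dynkin

section HeatKernel

variable {d : ℕ}

/-- The standard Gaussian density. -/
def gaussDensity (y : EuclideanSpace ℝ (Fin d)) : ℝ :=
  (∫ z : EuclideanSpace ℝ (Fin d), Real.exp (-(1 / 2) * ‖z‖ ^ 2))⁻¹ * Real.exp (-(1 / 2) * ‖y‖ ^ 2)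

lemma integrable_exp_neg_mul_norm_sq {b : ℝ} (hb : 0 < b) :
    Integrable fun y : EuclideanSpace ℝ (Fin d) => Real.exp (-b * ‖y‖ ^ 2) := by
  by_contra h
  have h1 := GaussianFourier.integral_rexp_neg_mul_sq_norm (V := EuclideanSpace ℝ (Fin d)) hb
  rw [integral_undef h] at h1
  exact (Real.rpow_pos_of_pos (div_pos Real.pi_pos hb) _).ne h1

lemma integral_exp_neg_half_norm_sq_pos :
    0 < ∫ z : EuclideanSpace ℝ (Fin d), Real.exp (-(1 / 2) * ‖z‖ ^ 2) := by
  rw [GaussianFourier.integral_rexp_neg_mul_sq_norm (V := EuclideanSpace ℝ (Fin d)) one_half_pos]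
  exact Real.rpow_pos_of_pos (div_pos Real.pi_pos one_half_pos) _

lemma gaussDensity_pos (y : EuclideanSpace ℝ (Fin d)) : 0 < gaussDensity y :=
  mul_pos (inv_pos.2 integral_exp_neg_half_norm_sq_pos) (Real.exp_pos _)

lemma continuous_gaussDensity : Continuous (gaussDensity (d := d)) := by
  unfold gaussDensity
  fun_prop

lemma integrable_gaussDensity : Integrable (gaussDensity (d := d)) :=
  (integrable_exp_neg_mul_norm_sq one_half_pos).const_mul _

lemma integral_gaussDensity : ∫ y, gaussDensity (d := d) y = 1 := by
  unfold gaussDensity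
  rw [integral_const_mul, inv_mul_cancel₀ integral_exp_neg_half_norm_sq_pos.ne']

lemma integrable_norm_mul_gaussDensity :
    Integrable fun y : EuclideanSpace ℝ (Fin d) => ‖y‖ * gaussDensity y := by
  have h1 : Integrable fun y : EuclideanSpace ℝ (Fin d) =>
      (∫ z : EuclideanSpace ℝ (Fin d), Real.exp (-(1 / 2) * ‖z‖ ^ 2))⁻¹
        * (2 * Real.exp (-(1 / 4) * ‖y‖ ^ 2)) :=
    ((integrable_exp_neg_mul_norm_sq (by norm_num)).const_mul 2).const_mul _
  refine h1.mono' (continuous_norm.mul continuous_gaussDensity).aestronglyMeasurable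
    (ae_of_all _ fun y => ?_)
  rw [Real.norm_eq_abs, abs_of_nonneg (mul_nonneg (norm_nonneg _) (gaussDensity_pos y).le),
    gaussDensity, mul_left_comm]
  refine mul_le_mul_of_nonneg_left ?_ (inv_pos.2 integral_exp_neg_half_norm_sq_pos).le
  have h2 : Real.exp (-(1 / 2) * ‖y‖ ^ 2)
      = Real.exp (-(1 / 4) * ‖y‖ ^ 2) * Real.exp (-(1 / 4) * ‖y‖ ^ 2) := by
    rw [← Real.exp_add]; ring_nf
  have h3 : ‖y‖ * Real.exp (-(1 / 4) * ‖y‖ ^ 2) ≤ 2 := by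
    have := Real.add_one_le_exp ((1 / 4) * ‖y‖ ^ 2)
    rw [neg_mul, Real.exp_neg, mul_inv_le_iff₀ (Real.exp_pos _)]
    nlinarith [sq_nonneg (‖y‖ - 2)]
  rw [h2]
  nlinarith [Real.exp_pos (-(1 / 4) * ‖y‖ ^ 2)]

lemma hasFDerivAt_gaussDensity (y : EuclideanSpace ℝ (Fin d)) :
    HasFDerivAt gaussDensity (-(gaussDensity y) • innerSL ℝ y) y := by
  have h1 := (((hasStrictFDerivAt_norm_sq y).hasFDerivAt.const_mul (-(1 / 2) : ℝ)).exp).const_mul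
    (∫ z : EuclideanSpace ℝ (Fin d), Real.exp (-(1 / 2) * ‖z‖ ^ 2))⁻¹
  refine h1.congr_fderiv ?_
  ext z
  simp [gaussDensity]
  ring

/-- The heat semigroup with diffusivity `α / 2`. -/
def heat (α v : ℝ) (f : EuclideanSpace ℝ (Fin d) → ℝ) (x : EuclideanSpace ℝ (Fin d)) : ℝ :=
  ∫ y, gaussDensity y * f (x - √(α * v) • y)

variable {α v C : ℝ} {f : EuclideanSpace ℝ (Fin d) → ℝ}

lemma heat_zero (α : ℝ) (f : EuclideanSpace ℝ (Fin d) → ℝ) : heat α 0 f = f := by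
  funext x
  simp [heat, integral_mul_const, integral_gaussDensity]

lemma norm_gaussDensity_mul_le (hC : ∀ x, |f x| ≤ C) (x y : EuclideanSpace ℝ (Fin d)) :
    ‖gaussDensity y * f x‖ ≤ gaussDensity y * C := by
  rw [norm_mul, Real.norm_eq_abs, abs_of_pos (gaussDensity_pos y)]
  exact mul_le_mul_of_nonneg_left (hC x) (gaussDensity_pos y).le

lemma integrable_gaussDensity_mul (hf : Measurable f) (hC : ∀ x, |f x| ≤ C)
    (x : EuclideanSpace ℝ (Fin d)) (σ : ℝ) :
    Integrable fun y => gaussDensity y * f (x - σ • y) :=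
  (integrable_gaussDensity.mul_const C).mono'
    (continuous_gaussDensity.measurable.mul (hf.comp (by fun_prop))).aestronglyMeasurable
    (ae_of_all _ fun y => norm_gaussDensity_mul_le hC _ y)

lemma abs_heat_le (hC : ∀ x, |f x| ≤ C) (x : EuclideanSpace ℝ (Fin d)) : |heat α v f x| ≤ C := by
  have := norm_integral_le_of_norm_le (integrable_gaussDensity.mul_const C)
    (ae_of_all _ fun y => norm_gaussDensity_mul_le hC (x - √(α * v) • y) y)
  rwa [integral_mul_const, integral_gaussDensity, one_mul] at this

lemma heat_mem_Icc (hf : ∀ x, f x ∈ Icc (0 : ℝ) 1) (x : EuclideanSpace ℝ (Fin d)) :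
    heat α v f x ∈ Icc (0 : ℝ) 1 := by
  refine ⟨integral_nonneg fun y => mul_nonneg (gaussDensity_pos y).le (hf _).1, ?_⟩
  refine (le_abs_self _).trans (abs_heat_le (fun x => ?_) x)
  rw [abs_of_nonneg (hf x).1]
  exact (hf x).2

lemma continuous_heat_space (hf : Continuous f) (hC : ∀ x, |f x| ≤ C) :
    Continuous (heat α v f) :=
  continuous_of_dominated
    (fun x => (integrable_gaussDensity_mul hf.measurable hC x _).aestronglyMeasurable)
    (fun x => ae_of_all _ fun y => norm_gaussDensity_mul_le hC _ y)
    (integrable_gaussDensity.mul_const C) (ae_of_all _ fun y => by fun_prop)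

lemma continuous_heat_time (hf : Continuous f) (hC : ∀ x, |f x| ≤ C)
    (x : EuclideanSpace ℝ (Fin d)) : Continuous fun v => heat α v f x :=
  continuous_of_dominated
    (fun v => (integrable_gaussDensity_mul hf.measurable hC x _).aestronglyMeasurable)
    (fun v => ae_of_all _ fun y => norm_gaussDensity_mul_le hC _ y)
    (integrable_gaussDensity.mul_const C) (ae_of_all _ fun y => by fun_prop)

end HeatKernel

section HeatDynkin

variable {d : ℕ} {k f : EuclideanSpace ℝ (Fin d) → ℝ}

open scoped Convolution in
lemma integral_mul_comp_sub_smul_eq_convolution {σ : ℝ} (hσ : σ ≠ 0) :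
    (fun x => ∫ y, k y * f (x - σ • y))
      = (fun z => |(σ ^ Module.finrank ℝ (EuclideanSpace ℝ (Fin d)))⁻¹| * k (σ⁻¹ • z))
        ⋆[ContinuousLinearMap.mul ℝ ℝ, volume] f := by
  funext x
  have h1 := Measure.integral_comp_smul volume (fun z => k (σ⁻¹ • z) * f (x - z)) σ
  simp only [smul_smul, inv_mul_cancel₀ hσ, one_smul] at h1
  rw [h1, smul_eq_mul, ← integral_const_mul]
  simp [convolution, mul_assoc]

lemma IsTest.smear (hf : IsTest f) {σ : ℝ} (hσ : σ ≠ 0) (hk : Integrable k)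
    (hks : HasCompactSupport k) : IsTest fun x => ∫ y, k y * f (x - σ • y) := by
  rw [integral_mul_comp_sub_smul_eq_convolution hσ]
  have hK : Integrable fun z =>
      |(σ ^ Module.finrank ℝ (EuclideanSpace ℝ (Fin d)))⁻¹| * k (σ⁻¹ • z) :=
    ((integrable_comp_smul_iff volume k (inv_ne_zero hσ)).2 hk).const_mul _
  have hKs : HasCompactSupport fun z =>
      |(σ ^ Module.finrank ℝ (EuclideanSpace ℝ (Fin d)))⁻¹| * k (σ⁻¹ • z) :=
    (hks.comp_smul (inv_ne_zero hσ)).mul_left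
  exact ⟨hf.supp.contDiff_convolution_right _ hK.locallyIntegrable hf.smooth,
    hKs.convolution _ hf.supp⟩

lemma IsTest.pderiv_smear (hf : IsTest f) {σ : ℝ} (hσ : σ ≠ 0) (hk : Integrable k) (i : Fin d) :
    _root_.pderiv i (fun x => ∫ y, k y * f (x - σ • y))
      = fun x => ∫ y, k y * _root_.pderiv i f (x - σ • y) := by
  rw [integral_mul_comp_sub_smul_eq_convolution hσ, integral_mul_comp_sub_smul_eq_convolution hσ]
  have hK : Integrable fun z =>
      |(σ ^ Module.finrank ℝ (EuclideanSpace ℝ (Fin d)))⁻¹| * k (σ⁻¹ • z) :=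
    ((integrable_comp_smul_iff volume k (inv_ne_zero hσ)).2 hk).const_mul _
  have h1 : ContDiff ℝ 1 f := hf.smooth.of_le (by simp)
  funext x
  rw [_root_.pderiv, (hf.supp.hasFDerivAt_convolution_right _ hK.locallyIntegrable h1 x).fderiv,
    convolution_precompR_apply _ hK.locallyIntegrable (hf.supp.fderiv ℝ)
      (h1.continuous_fderiv (by simp))]
  rfl

lemma IsTest.laplacian_smear (hf : IsTest f) {σ : ℝ} (hσ : σ ≠ 0) (hk : Integrable k) :
    _root_.laplacian (fun x => ∫ y, k y * f (x - σ • y))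
      = fun x => ∫ y, k y * _root_.laplacian f (x - σ • y) := by
  simp only [laplacian_eq_sum_pderiv, hf.pderiv_smear hσ hk, (hf.pderiv _).pderiv_smear hσ hk]
  funext x
  have hint : ∀ i, Integrable fun y => k y * _root_.pderiv i (_root_.pderiv i f) (x - σ • y) := by
    intro i
    obtain ⟨C, hC⟩ := ((hf.pderiv i).pderiv i).exists_bound
    exact hk.mul_bdd (c := C) (((hf.pderiv i).pderiv i).continuous.comp
      (by fun_prop)).aestronglyMeasurable (ae_of_all _ fun y => hC _)
  rw [← integral_finsetSum _ fun i _ => hint i]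
  simp only [Finset.mul_sum]

/-- Truncation of the Gaussian density to a ball of radius `n`. -/
def gaussTrunc (n : ℕ) : EuclideanSpace ℝ (Fin d) → ℝ :=
  (Metric.closedBall 0 (n : ℝ)).indicator gaussDensity

lemma gaussTrunc_nonneg (n : ℕ) (y : EuclideanSpace ℝ (Fin d)) : 0 ≤ gaussTrunc n y :=
  indicator_nonneg (fun y _ => (gaussDensity_pos y).le) y

lemma gaussTrunc_le (n : ℕ) (y : EuclideanSpace ℝ (Fin d)) : gaussTrunc n y ≤ gaussDensity y :=
  indicator_le_self' (fun y _ => (gaussDensity_pos y).le) y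

lemma integrable_gaussTrunc (n : ℕ) : Integrable (gaussTrunc (d := d) n) :=
  integrable_gaussDensity.indicator measurableSet_closedBall

lemma hasCompactSupport_gaussTrunc (n : ℕ) : HasCompactSupport (gaussTrunc (d := d) n) :=
  HasCompactSupport.of_support_subset_isCompact (isCompact_closedBall 0 (n : ℝ))
    support_indicator_subset

lemma norm_gaussTrunc_mul_le {C : ℝ} (hC : ∀ x, |f x| ≤ C) (n : ℕ)
    (x y : EuclideanSpace ℝ (Fin d)) : ‖gaussTrunc n y * f x‖ ≤ gaussDensity y * C := by
  rw [norm_mul, Real.norm_eq_abs, abs_of_nonneg (gaussTrunc_nonneg n y)]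
  exact mul_le_mul (gaussTrunc_le n y) (hC x) (abs_nonneg _) (gaussDensity_pos y).le

lemma abs_integral_gaussTrunc_mul_le {C : ℝ} (hC : ∀ x, |f x| ≤ C) (n : ℕ)
    (x : EuclideanSpace ℝ (Fin d)) (σ : ℝ) : |∫ y, gaussTrunc n y * f (x - σ • y)| ≤ C := by
  have := norm_integral_le_of_norm_le (integrable_gaussDensity.mul_const C)
    (ae_of_all _ fun y => norm_gaussTrunc_mul_le hC n (x - σ • y) y)
  rwa [integral_mul_const, integral_gaussDensity, one_mul] at this

lemma tendsto_integral_gaussTrunc_mul {C : ℝ} (hf : Continuous f) (hC : ∀ x, |f x| ≤ C)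
    (α v : ℝ) (x : EuclideanSpace ℝ (Fin d)) :
    Tendsto (fun n : ℕ => ∫ y, gaussTrunc n y * f (x - √(α * v) • y)) atTop
      (nhds (heat α v f x)) := by
  refine tendsto_integral_of_dominated_convergence (fun y => gaussDensity y * C)
    (fun n => ((integrable_gaussTrunc n).aestronglyMeasurable.mul
      (hf.comp (by fun_prop)).aestronglyMeasurable))
    (integrable_gaussDensity.mul_const C)
    (fun n => ae_of_all _ fun y => norm_gaussTrunc_mul_le hC n _ y) (ae_of_all _ fun y => ?_)
  refine tendsto_const_nhds.congr' ?_
  obtain ⟨N, hN⟩ := exists_nat_ge ‖y‖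
  filter_upwards [eventually_ge_atTop N] with n hn
  have : y ∈ Metric.closedBall (0 : EuclideanSpace ℝ (Fin d)) (n : ℝ) := by
    rw [mem_closedBall_zero_iff]
    exact hN.trans (by exact_mod_cast hn)
  rw [gaussTrunc, indicator_of_mem this]

variable {T α c v : ℝ} {Ω : Type*} {mΩ : MeasurableSpace Ω} {P : Measure Ω}
  {ℱ : Filtration ℝ mΩ} {μ0 : ProbabilityMeasure (EuclideanSpace ℝ (Fin d))}
  {μ : ℝ → Ω → ProbabilityMeasure (EuclideanSpace ℝ (Fin d))} [IsProbabilityMeasure P]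

lemma IsMPSolution.dynkinFormula_heat (h : IsMPSolution d T α ℱ P μ0 μ)
    (hc : c ∈ Ico (0 : ℝ) 1) (hf : ∀ x, f x ∈ Icc (0 : ℝ) 1) (hft : IsTest f) (hα : 0 < α)
    (hv : 0 ≤ v) : DynkinFormula P μ T α c (heat α v f) (heat α v (laplacian f)) := by
  rcases hv.eq_or_lt with rfl | hv
  · simpa only [heat_zero] using h.dynkinFormula_isTest hc hf hft
  have hσ : √(α * v) ≠ 0 := (Real.sqrt_pos.2 (mul_pos hα hv)).ne'
  obtain ⟨C, hC⟩ := hft.laplacian.exists_bound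
  have hf1 : ∀ x, |f x| ≤ 1 := fun x => by rw [abs_of_nonneg (hf x).1]; exact (hf x).2
  have hG : ∀ (n : ℕ) x, ∫ y, gaussTrunc n y * f (x - √(α * v) • y) ∈ Icc (0 : ℝ) 1 := fun n x =>
    ⟨integral_nonneg fun y => mul_nonneg (gaussTrunc_nonneg n y) (hf _).1,
      (le_abs_self _).trans (abs_integral_gaussTrunc_mul_le hf1 n x _)⟩
  have hGt := fun n : ℕ => hft.smear hσ (integrable_gaussTrunc n) (hasCompactSupport_gaussTrunc n)
  have hLt := fun n : ℕ => hft.laplacian.smear hσ (integrable_gaussTrunc n)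
    (hasCompactSupport_gaussTrunc n)
  refine h.dynkinFormula_of_tendsto hc (fun n => ?_) hG (fun n => (hGt n).continuous)
    (tendsto_integral_gaussTrunc_mul hft.continuous hf1 α v) (fun n => (hLt n).continuous)
    (fun n x => abs_integral_gaussTrunc_mul_le hC n x _)
    (tendsto_integral_gaussTrunc_mul hft.laplacian.continuous hC α v)
  rw [← hft.laplacian_smear hσ (integrable_gaussTrunc n)]
  exact h.dynkinFormula_isTest hc (hG n) (hGt n)

end HeatDynkin

section HeatEquation

variable {d : ℕ} {f : EuclideanSpace ℝ (Fin d) → ℝ}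

lemma fderiv_apply_eq_sum_pderiv (f : EuclideanSpace ℝ (Fin d) → ℝ)
    (z y : EuclideanSpace ℝ (Fin d)) : fderiv ℝ f z y = ∑ i, y i * pderiv i f z := by
  conv_lhs => rw [← (EuclideanSpace.basisFun (Fin d) ℝ).sum_repr y]
  simp [pderiv, map_sum]

lemma IsTest.integrable_coord_mul_gaussDensity_mul (hf : IsTest f) (x : EuclideanSpace ℝ (Fin d))
    (σ : ℝ) (i : Fin d) : Integrable fun y => gaussDensity y * (y i * f (x - σ • y)) := by
  obtain ⟨C, hC⟩ := hf.exists_bound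
  have h1 : Continuous fun y => gaussDensity y * (y i * f (x - σ • y)) :=
    continuous_gaussDensity.mul (Continuous.mul (by fun_prop) (hf.continuous.comp (by fun_prop)))
  refine (integrable_norm_mul_gaussDensity.mul_const C).mono' h1.aestronglyMeasurable
    (ae_of_all _ fun y => ?_)
  rw [norm_mul, norm_mul, Real.norm_eq_abs, abs_of_pos (gaussDensity_pos y), mul_comm ‖y‖,
    mul_assoc]
  exact mul_le_mul_of_nonneg_left (mul_le_mul (PiLp.norm_apply_le y i) (hC _) (norm_nonneg _)
    (norm_nonneg _)) (gaussDensity_pos y).le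

/-- Gaussian integration by parts. -/
lemma IsTest.integral_gaussDensity_coord_mul (hf : IsTest f) (x : EuclideanSpace ℝ (Fin d))
    (σ : ℝ) (i : Fin d) : ∫ y, gaussDensity y * (y i * f (x - σ • y))
      = -(σ * ∫ y, gaussDensity y * _root_.pderiv i f (x - σ • y)) := by
  have hd1 : ∀ y, HasFDerivAt (fun y => f (x - σ • y))
      ((fderiv ℝ f (x - σ • y)).comp (-(σ • ContinuousLinearMap.id ℝ _))) y := fun y =>
    (hf.differentiable _).hasFDerivAt.comp y (((hasFDerivAt_id y).const_smul σ).const_sub x)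
  have e1 : ∀ y, fderiv ℝ (fun y => f (x - σ • y)) y (EuclideanSpace.single i 1)
      = -(σ * _root_.pderiv i f (x - σ • y)) := fun y => by
    rw [(hd1 y).fderiv]; simp [_root_.pderiv]
  have e2 : ∀ y : EuclideanSpace ℝ (Fin d), fderiv ℝ gaussDensity y (EuclideanSpace.single i 1)
      = -(gaussDensity y * y i) := fun y => by
    rw [(hasFDerivAt_gaussDensity y).fderiv]
    simp [EuclideanSpace.inner_single_right]
  obtain ⟨C, hC⟩ := hf.exists_bound
  obtain ⟨C', hC'⟩ := (hf.pderiv i).exists_bound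
  have i1 := integrable_gaussDensity_mul hf.continuous.measurable hC x σ
  have i2 := integrable_gaussDensity_mul (hf.pderiv i).continuous.measurable hC' x σ
  have i3 := hf.integrable_coord_mul_gaussDensity_mul x σ i
  have key := integral_mul_fderiv_eq_neg_fderiv_mul_of_integrable (μ := volume)
    (f := fun y => f (x - σ • y)) (g := gaussDensity) (v := EuclideanSpace.single i 1)
    (by simp only [e1]; refine (i2.const_mul (-σ)).congr (ae_of_all _ fun y => ?_); ring)
    (by simp only [e2]; refine i3.neg.congr (ae_of_all _ fun y => ?_)
        simp only [Pi.neg_apply]; ring)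
    (by refine i1.congr (ae_of_all _ fun y => ?_); ring)
    (fun y _ => (hd1 y).differentiableAt)
    (fun y _ => (hasFDerivAt_gaussDensity y).differentiableAt)
  simp only [e1, e2] at key
  rw [← integral_const_mul, ← neg_inj, neg_neg, ← integral_neg]
  have key' : ∫ y, -(gaussDensity y * (y i * f (x - σ • y)))
      = -∫ y, -(σ * _root_.pderiv i f (x - σ • y)) * gaussDensity y := by
    rw [← key]; congr 1 with y; ring
  rw [key', ← integral_neg]
  congr 1 with y
  ring

/-- The heat equation. -/
lemma IsTest.hasDerivAt_heat (hf : IsTest f) {α v : ℝ} (hα : 0 < α) (hv : 0 < v)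
    (x : EuclideanSpace ℝ (Fin d)) :
    HasDerivAt (fun v => heat α v f x) (α / 2 * heat α v (_root_.laplacian f) x) v := by
  obtain ⟨C, hC⟩ := hf.exists_bound
  have hcd : Continuous (fderiv ℝ f) := hf.smooth.continuous_fderiv (by simp)
  obtain ⟨K, hK⟩ := hcd.bounded_above_of_compact_support (hf.supp.fderiv ℝ)
  have hK0 : 0 ≤ K := (norm_nonneg _).trans (hK 0)
  set S := α / (2 * √(α * (v / 2))) with hS
  have hsp : ∀ {u : ℝ}, 0 < u → 0 < √(α * u) := fun hu => Real.sqrt_pos.2 (mul_pos hα hu)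
  have hsd : ∀ u, 0 < u → HasDerivAt (fun u => √(α * u)) (α / (2 * √(α * u))) u := fun u hu => by
    simpa using ((hasDerivAt_id u).const_mul α).sqrt (mul_pos hα hu).ne'
  have hmain := (hasDerivAt_integral_of_dominated_loc_of_deriv_le (μ := volume)
    (F := fun u y => gaussDensity y * f (x - √(α * u) • y)) (x₀ := v) (s := Ioi (v / 2))
    (F' := fun u y => gaussDensity y * fderiv ℝ f (x - √(α * u) • y)
      (-((α / (2 * √(α * u))) • y)))
    (bound := fun y => S * K * (‖y‖ * gaussDensity y)) (Ioi_mem_nhds (by linarith))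
    (Eventually.of_forall fun u =>
      (integrable_gaussDensity_mul hf.continuous.measurable hC x _).aestronglyMeasurable)
    (integrable_gaussDensity_mul hf.continuous.measurable hC x _)
    (Continuous.aestronglyMeasurable (continuous_gaussDensity.mul
      ((hcd.comp (by fun_prop)).clm_apply (by fun_prop))))
    (ae_of_all _ fun y u hu => ?_) (integrable_norm_mul_gaussDensity.const_mul _)
    (ae_of_all _ fun y u hu => ?_)).2
  · refine hmain.congr_deriv ?_
    obtain ⟨C', hC'⟩ := hf.laplacian.exists_bound
    have hσ := hsp hv
    have hib := fun i => integrable_gaussDensity_mul (((hf.pderiv i).pderiv i).continuous.measurable)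
      ((hf.pderiv i).pderiv i).exists_bound.choose_spec x √(α * v)
    have e1 : ∀ y : EuclideanSpace ℝ (Fin d), gaussDensity y * fderiv ℝ f (x - √(α * v) • y)
        (-((α / (2 * √(α * v))) • y)) = ∑ i, -(α / (2 * √(α * v))) *
          (gaussDensity y * (y i * _root_.pderiv i f (x - √(α * v) • y))) := fun y => by
      rw [map_neg, map_smul, fderiv_apply_eq_sum_pderiv, smul_eq_mul, Finset.mul_sum,
        ← Finset.sum_neg_distrib, Finset.mul_sum]
      exact Finset.sum_congr rfl fun i _ => by ring
    simp only [e1]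
    rw [integral_finsetSum _ fun i _ =>
      ((hf.pderiv i).integrable_coord_mul_gaussDensity_mul x _ i).const_mul _]
    simp only [integral_const_mul, (hf.pderiv _).integral_gaussDensity_coord_mul]
    rw [heat, laplacian_eq_sum_pderiv]
    simp only [Finset.mul_sum]
    rw [integral_finsetSum _ fun i _ => hib i, Finset.mul_sum]
    refine Finset.sum_congr rfl fun i _ => ?_
    field_simp
  · have hu0 : 0 < u := (half_pos hv).trans hu
    have h1 : α / (2 * √(α * u)) ≤ S := by
      rw [hS]
      have := hsp (half_pos hv)
      gcongr
      exact le_of_lt hu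
    have h0 : 0 ≤ α / (2 * √(α * u)) := by positivity
    rw [norm_mul, Real.norm_eq_abs, abs_of_pos (gaussDensity_pos y)]
    have h2 : ‖fderiv ℝ f (x - √(α * u) • y) (-((α / (2 * √(α * u))) • y))‖ ≤ K * (S * ‖y‖) := by
      refine (ContinuousLinearMap.le_opNorm _ _).trans
        (mul_le_mul (hK _) ?_ (norm_nonneg _) hK0)
      rw [norm_neg, norm_smul, Real.norm_eq_abs, abs_of_nonneg h0]
      exact mul_le_mul_of_nonneg_right h1 (norm_nonneg _)
    calc _ ≤ gaussDensity y * (K * (S * ‖y‖)) :=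
          mul_le_mul_of_nonneg_left h2 (gaussDensity_pos y).le
      _ = _ := by ring
  · have hu0 : 0 < u := (half_pos hv).trans hu
    have h1 : HasDerivAt (fun u => x - √(α * u) • y) (-((α / (2 * √(α * u))) • y)) u :=
      ((hsd u hu0).smul_const y).const_sub x
    exact ((hf.differentiable _).hasFDerivAt.comp_hasDerivAt u h1).const_mul _

lemma IsTest.abs_heat_sub_le (hf : IsTest f) {α C : ℝ} (hα : 0 < α)
    (hC : ∀ x, |_root_.laplacian f x| ≤ C) (x : EuclideanSpace ℝ (Fin d)) {u v : ℝ} (hu : 0 ≤ u)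
    (hv : 0 ≤ v) : |heat α v f x - heat α u f x| ≤ α / 2 * C * |v - u| := by
  have h1 : ∀ u ∈ Ioi (0 : ℝ), ∀ v ∈ Ioi (0 : ℝ),
      |heat α v f x - heat α u f x| ≤ α / 2 * C * |v - u| := fun u hu v hv =>
    Convex.norm_image_sub_le_of_norm_hasDerivWithin_le (s := Ioi 0)
      (fun w hw => (hf.hasDerivAt_heat hα hw x).hasDerivWithinAt)
      (fun w _ => by
        rw [norm_mul, Real.norm_eq_abs, abs_of_pos (half_pos hα)]
        exact mul_le_mul_of_nonneg_left (abs_heat_le hC x) (half_pos hα).le)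
      (convex_Ioi 0) hu hv
  obtain ⟨K, hK⟩ := hf.exists_bound
  have hc := continuous_heat_time (α := α) hf.continuous hK x
  have h2 : Tendsto (fun e : ℝ => |heat α (v + e) f x - heat α (u + e) f x|) (nhdsWithin 0 (Ioi 0))
      (nhds |heat α v f x - heat α u f x|) := by
    have : Continuous fun e : ℝ => |heat α (v + e) f x - heat α (u + e) f x| :=
      ((hc.comp (by fun_prop)).sub (hc.comp (by fun_prop))).abs
    simpa using (this.tendsto 0).mono_left nhdsWithin_le_nhds
  refine le_of_tendsto h2 ?_
  filter_upwards [self_mem_nhdsWithin] with e he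
  simpa using h1 (u + e) (add_pos_of_nonneg_of_pos hu he) (v + e) (add_pos_of_nonneg_of_pos hv he)

end HeatEquation

section ExpLogLipschitz

variable {d : ℕ} {α c : ℝ} {g g' ℓ ℓ' : EuclideanSpace ℝ (Fin d) → ℝ}

lemma abs_log_sub_log_le {a b δ : ℝ} (hδ : 0 < δ) (ha : δ ≤ a) (hb : δ ≤ b) :
    |Real.log a - Real.log b| ≤ |a - b| / δ := by
  have key : ∀ {a b : ℝ}, δ ≤ a → δ ≤ b → Real.log a - Real.log b ≤ |a - b| / δ := by
    intro a b ha hb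
    have ha0 := hδ.trans_le ha
    have hb0 := hδ.trans_le hb
    rw [← Real.log_div ha0.ne' hb0.ne']
    calc Real.log (a / b) ≤ a / b - 1 := Real.log_le_sub_one_of_pos (div_pos ha0 hb0)
      _ = (a - b) / b := by field_simp
      _ ≤ |a - b| / b := by gcongr; exact le_abs_self _
      _ ≤ |a - b| / δ := by gcongr
  refine abs_le.2 ⟨?_, key ha hb⟩
  have := key hb ha
  rw [abs_sub_comm] at this
  linarith

lemma abs_exp_sub_exp_le {a b B : ℝ} (ha : Real.exp a ≤ B) (hb : Real.exp b ≤ B) :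
    |Real.exp a - Real.exp b| ≤ B * |a - b| := by
  have key : ∀ {a b : ℝ}, Real.exp a ≤ B → Real.exp a - Real.exp b ≤ B * |a - b| := by
    intro a b ha
    have h1 : Real.exp b = Real.exp a * Real.exp (b - a) := by rw [← Real.exp_add]; ring_nf
    have h2 := Real.add_one_le_exp (b - a)
    have h3 : Real.exp a - Real.exp b ≤ Real.exp a * (a - b) := by
      rw [h1]; nlinarith [Real.exp_pos a]
    refine h3.trans ((mul_le_mul_of_nonneg_left (le_abs_self _) (Real.exp_pos a).le).trans ?_)
    gcongr
  refine abs_le.2 ⟨?_, key ha⟩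
  have := key (a := b) (b := a) hb
  rw [abs_sub_comm] at this
  linarith

lemma abs_pairing_sub_le {ν : ProbabilityMeasure (EuclideanSpace ℝ (Fin d))}
    (hg : Integrable g (ν : Measure (EuclideanSpace ℝ (Fin d))))
    (hg' : Integrable g' (ν : Measure (EuclideanSpace ℝ (Fin d)))) {ε : ℝ}
    (h : ∀ x, |g x - g' x| ≤ ε) : |pairing ν g - pairing ν g'| ≤ ε := by
  rw [pairing, pairing, ← integral_sub hg hg']
  exact abs_pairing_le h

lemma integrable_mul_log (hc : c ∈ Ico (0 : ℝ) 1) (hg : ∀ x, g x ∈ Icc (0 : ℝ) 1)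
    (hgm : Measurable g) (ν : ProbabilityMeasure (EuclideanSpace ℝ (Fin d))) :
    Integrable (fun x => α * Real.log (1 - c * g x))
      (ν : Measure (EuclideanSpace ℝ (Fin d))) :=
  integrable_of_measurable_of_abs_le (by fun_prop) (abs_mul_log_le hc hg)

lemma integrable_mul_div (hc : c ∈ Ico (0 : ℝ) 1) (hg : ∀ x, g x ∈ Icc (0 : ℝ) 1)
    (hgm : Measurable g) (hℓm : Measurable ℓ) {C : ℝ} (hℓ : ∀ x, |ℓ x| ≤ C)
    (ν : ProbabilityMeasure (EuclideanSpace ℝ (Fin d))) :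
    Integrable (fun x => -(c * α ^ 2 / 2) * (ℓ x / (1 - c * g x)))
      (ν : Measure (EuclideanSpace ℝ (Fin d))) :=
  integrable_of_measurable_of_abs_le (by fun_prop) (abs_mul_div_le hc hg hℓ)

lemma abs_expLog_sub_le (hc : c ∈ Ico (0 : ℝ) 1) (hg : ∀ x, g x ∈ Icc (0 : ℝ) 1)
    (hg' : ∀ x, g' x ∈ Icc (0 : ℝ) 1) (hgm : Measurable g) (hgm' : Measurable g') {ε : ℝ}
    (hε : ∀ x, |g x - g' x| ≤ ε) (ν : ProbabilityMeasure (EuclideanSpace ℝ (Fin d))) :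
    |expLog α c g ν - expLog α c g' ν|
      ≤ Real.exp (|α| * -Real.log (1 - c)) * (|α| * (c * ε / (1 - c))) := by
  refine (abs_exp_sub_exp_le (expLog_le hc hg ν) (expLog_le hc hg' ν)).trans ?_
  refine mul_le_mul_of_nonneg_left ?_ (Real.exp_pos _).le
  refine abs_pairing_sub_le (integrable_mul_log hc hg hgm ν) (integrable_mul_log hc hg' hgm' ν)
    fun x => ?_
  rw [← mul_sub, abs_mul]
  refine mul_le_mul_of_nonneg_left ?_ (abs_nonneg _)
  refine (abs_log_sub_log_le (sub_pos.2 hc.2) (one_sub_mul_ge hc.1 hg x)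
    (one_sub_mul_ge hc.1 hg' x)).trans ?_
  have h1 : |1 - c * g x - (1 - c * g' x)| = c * |g x - g' x| := by
    rw [show 1 - c * g x - (1 - c * g' x) = -(c * (g x - g' x)) by ring, abs_neg, abs_mul,
      abs_of_nonneg hc.1]
  rw [h1]
  have := sub_pos.2 hc.2
  have := hc.1
  gcongr
  exact hε x

lemma abs_div_sub_div_le (hc : c ∈ Ico (0 : ℝ) 1) (hg : ∀ x, g x ∈ Icc (0 : ℝ) 1)
    (hg' : ∀ x, g' x ∈ Icc (0 : ℝ) 1) {ε C : ℝ} (hε : ∀ x, |g x - g' x| ≤ ε)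
    (hε' : ∀ x, |ℓ x - ℓ' x| ≤ ε) (hℓ' : ∀ x, |ℓ' x| ≤ C) (x : EuclideanSpace ℝ (Fin d)) :
    |ℓ x / (1 - c * g x) - ℓ' x / (1 - c * g' x)| ≤ ε / (1 - c) + C * ε / (1 - c) ^ 2 := by
  have p1 := one_sub_mul_pos hc hg x
  have p2 := one_sub_mul_pos hc hg' x
  have p := sub_pos.2 hc.2
  have e : ℓ x / (1 - c * g x) - ℓ' x / (1 - c * g' x) = (ℓ x - ℓ' x) / (1 - c * g x)
      + ℓ' x * (c * (g x - g' x)) / ((1 - c * g x) * (1 - c * g' x)) := by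
    field_simp
    ring
  rw [e]
  have hε0 : 0 ≤ ε := (abs_nonneg _).trans (hε x)
  have hC0 : 0 ≤ C := (abs_nonneg _).trans (hℓ' x)
  refine (abs_add_le _ _).trans (add_le_add ?_ ?_)
  · rw [abs_div, abs_of_pos p1]
    exact div_le_div₀ hε0 (hε' x) p (one_sub_mul_ge hc.1 hg x)
  · rw [abs_div, abs_mul, abs_mul, abs_of_pos (mul_pos p1 p2), abs_of_nonneg hc.1, pow_two]
    refine div_le_div₀ (mul_nonneg hC0 hε0) ?_ (mul_pos p p) (mul_le_mul
      (one_sub_mul_ge hc.1 hg x) (one_sub_mul_ge hc.1 hg' x) p.le p1.le)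
    refine mul_le_mul (hℓ' x) ?_ (mul_nonneg hc.1 (abs_nonneg _)) hC0
    nlinarith [hε x, hc.1, hc.2, abs_nonneg (g x - g' x)]

lemma abs_expLogGen_sub_le (hc : c ∈ Ico (0 : ℝ) 1) (hg : ∀ x, g x ∈ Icc (0 : ℝ) 1)
    (hg' : ∀ x, g' x ∈ Icc (0 : ℝ) 1) (hgm : Measurable g) (hgm' : Measurable g')
    (hℓm : Measurable ℓ) (hℓm' : Measurable ℓ') {ε C : ℝ} (hε : ∀ x, |g x - g' x| ≤ ε)
    (hε' : ∀ x, |ℓ x - ℓ' x| ≤ ε) (hℓ : ∀ x, |ℓ x| ≤ C) (hℓ' : ∀ x, |ℓ' x| ≤ C)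
    (ν : ProbabilityMeasure (EuclideanSpace ℝ (Fin d))) :
    |expLogGen α c g ℓ ν - expLogGen α c g' ℓ' ν|
      ≤ Real.exp (|α| * -Real.log (1 - c)) * (|α| * (c * ε / (1 - c)))
          * (|-(c * α ^ 2 / 2)| * (C / (1 - c)))
        + Real.exp (|α| * -Real.log (1 - c))
          * (|-(c * α ^ 2 / 2)| * (ε / (1 - c) + C * ε / (1 - c) ^ 2)) := by
  have h1 := abs_expLog_sub_le (α := α) hc hg hg' hgm hgm' hε ν
  have h2 : |(pairing ν fun x => -(c * α ^ 2 / 2) * (ℓ x / (1 - c * g x)))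
      - pairing ν fun x => -(c * α ^ 2 / 2) * (ℓ' x / (1 - c * g' x))|
      ≤ |-(c * α ^ 2 / 2)| * (ε / (1 - c) + C * ε / (1 - c) ^ 2) := by
    refine abs_pairing_sub_le (integrable_mul_div hc hg hgm hℓm hℓ ν)
      (integrable_mul_div hc hg' hgm' hℓm' hℓ' ν) fun x => ?_
    rw [← mul_sub, abs_mul]
    exact mul_le_mul_of_nonneg_left (abs_div_sub_div_le hc hg hg' hε hε' hℓ' x) (abs_nonneg _)
  have h3 : |pairing ν fun x => -(c * α ^ 2 / 2) * (ℓ x / (1 - c * g x))|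
      ≤ |-(c * α ^ 2 / 2)| * (C / (1 - c)) := abs_pairing_le (abs_mul_div_le hc hg hℓ)
  rw [expLogGen, expLogGen]
  rw [show ∀ a b a' b' : ℝ, a * b - a' * b' = (a - a') * b + a' * (b - b') by intros; ring]
  refine (abs_add_le _ _).trans (add_le_add ?_ ?_)
  · rw [abs_mul]
    exact mul_le_mul h1 h3 (abs_nonneg _) ((abs_nonneg _).trans h1)
  · rw [abs_mul, abs_of_pos (expLog_pos ν)]
    exact mul_le_mul (expLog_le hc hg' ν) h2 (abs_nonneg _) (Real.exp_pos _).le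

end ExpLogLipschitz

section HeatFlow

variable {d : ℕ} {α c : ℝ} {f : EuclideanSpace ℝ (Fin d) → ℝ}

/-- `expLog` along the heat flow of `f`. -/
def expLogHeat (α c : ℝ) (f : EuclideanSpace ℝ (Fin d) → ℝ) (v : ℝ)
    (ν : ProbabilityMeasure (EuclideanSpace ℝ (Fin d))) : ℝ :=
  expLog α c (heat α v f) ν

/-- `expLogGen` along the heat flow of `f`. -/
def expLogGenHeat (α c : ℝ) (f : EuclideanSpace ℝ (Fin d) → ℝ) (v : ℝ)
    (ν : ProbabilityMeasure (EuclideanSpace ℝ (Fin d))) : ℝ :=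
  expLogGen α c (heat α v f) (heat α v (laplacian f)) ν

lemma IsTest.exists_lipschitz_expLogHeat (hft : IsTest f) (hα : 0 < α)
    (hc : c ∈ Ico (0 : ℝ) 1) (hf : ∀ x, f x ∈ Icc (0 : ℝ) 1) :
    ∃ L, ∀ u v, 0 ≤ u → 0 ≤ v → ∀ ν,
      |expLogHeat α c f v ν - expLogHeat α c f u ν| ≤ L * |v - u| ∧
      |expLogGenHeat α c f v ν - expLogGenHeat α c f u ν| ≤ L * |v - u| := by
  obtain ⟨C, hC⟩ := hft.laplacian.exists_bound
  obtain ⟨C', hC'⟩ := hft.laplacian.laplacian.exists_bound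
  have hf1 : ∀ x, |f x| ≤ 1 := fun x => by rw [abs_of_nonneg (hf x).1]; exact (hf x).2
  set K := α / 2 * max C C' with hK
  set L₁ := Real.exp (|α| * -Real.log (1 - c)) * (|α| * (c * K / (1 - c))) with hL₁
  set L₂ := L₁ * (|-(c * α ^ 2 / 2)| * (C / (1 - c))) + Real.exp (|α| * -Real.log (1 - c))
    * (|-(c * α ^ 2 / 2)| * (K / (1 - c) + C * K / (1 - c) ^ 2)) with hL₂
  have hm : ∀ v, Measurable (heat α v f) := fun v =>
    (continuous_heat_space hft.continuous hf1).measurable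
  have hm' : ∀ v, Measurable (heat α v (_root_.laplacian f)) := fun v =>
    (continuous_heat_space hft.laplacian.continuous hC).measurable
  refine ⟨max L₁ L₂, fun u v hu hv ν => ⟨?_, ?_⟩⟩
  · have h1 : ∀ x, |heat α v f x - heat α u f x| ≤ K * |v - u| := fun x =>
      (hft.abs_heat_sub_le hα hC x hu hv).trans (by
        rw [hK]; gcongr; exact le_max_left _ _)
    refine (abs_expLog_sub_le hc (heat_mem_Icc hf) (heat_mem_Icc hf) (hm v) (hm u) h1 ν).trans ?_
    refine le_trans (le_of_eq ?_) (mul_le_mul_of_nonneg_right (le_max_left L₁ L₂) (abs_nonneg _))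
    rw [hL₁]; ring
  · have h1 : ∀ x, |heat α v f x - heat α u f x| ≤ K * |v - u| := fun x =>
      (hft.abs_heat_sub_le hα hC x hu hv).trans (by
        rw [hK]; gcongr; exact le_max_left _ _)
    have h2 : ∀ x, |heat α v (_root_.laplacian f) x - heat α u (_root_.laplacian f) x|
        ≤ K * |v - u| := fun x =>
      (hft.laplacian.abs_heat_sub_le hα hC' x hu hv).trans (by
        rw [hK]; gcongr; exact le_max_right _ _)
    refine (abs_expLogGen_sub_le hc (heat_mem_Icc hf) (heat_mem_Icc hf) (hm v) (hm u) (hm' v)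
      (hm' u) h1 h2 (abs_heat_le hC) (abs_heat_le hC) ν).trans ?_
    refine le_trans (le_of_eq ?_) (mul_le_mul_of_nonneg_right (le_max_right L₁ L₂) (abs_nonneg _))
    rw [hL₂, hL₁]; ring

lemma IsTest.hasDerivAt_expLogHeat (hft : IsTest f) (hα : 0 < α) (hc : c ∈ Ico (0 : ℝ) 1)
    (hf : ∀ x, f x ∈ Icc (0 : ℝ) 1) {v : ℝ} (hv : 0 < v)
    (ν : ProbabilityMeasure (EuclideanSpace ℝ (Fin d))) :
    HasDerivAt (fun v => expLogHeat α c f v ν) (expLogGenHeat α c f v ν) v := by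
  obtain ⟨C, hC⟩ := hft.laplacian.exists_bound
  have hf1 : ∀ x, |f x| ≤ 1 := fun x => by rw [abs_of_nonneg (hf x).1]; exact (hf x).2
  have hm : ∀ v, Measurable (heat α v f) := fun v =>
    (continuous_heat_space hft.continuous hf1).measurable
  have hm' : ∀ v, Measurable (heat α v (_root_.laplacian f)) := fun v =>
    (continuous_heat_space hft.laplacian.continuous hC).measurable
  have h1 : HasDerivAt (fun v => pairing ν fun x => α * Real.log (1 - c * heat α v f x))
      (pairing ν fun x => -(c * α ^ 2 / 2) *
        (heat α v (_root_.laplacian f) x / (1 - c * heat α v f x))) v := by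
    refine (hasDerivAt_integral_of_dominated_loc_of_deriv_le (s := Ioi 0)
      (F' := fun v x => -(c * α ^ 2 / 2) *
        (heat α v (_root_.laplacian f) x / (1 - c * heat α v f x)))
      (bound := fun _ => |-(c * α ^ 2 / 2)| * (C / (1 - c))) (Ioi_mem_nhds hv)
      (Eventually.of_forall fun u =>
        (integrable_mul_log hc (heat_mem_Icc hf) (hm u) ν).aestronglyMeasurable)
      (integrable_mul_log hc (heat_mem_Icc hf) (hm v) ν)
      (integrable_mul_div hc (heat_mem_Icc hf) (hm v) (hm' v) (abs_heat_le hC)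
        ν).aestronglyMeasurable
      (ae_of_all _ fun x u _ => abs_mul_div_le hc (heat_mem_Icc hf) (abs_heat_le hC) x)
      (integrable_const _) (ae_of_all _ fun x u hu => ?_)).2
    have h2 := ((((hft.hasDerivAt_heat hα hu x).const_mul c).const_sub 1).log
      (one_sub_mul_pos hc (heat_mem_Icc hf) x).ne').const_mul α
    refine h2.congr_deriv ?_
    ring
  exact h1.exp

lemma IsTest.abs_expLogHeat_sub_add_le (hft : IsTest f) (hα : 0 < α) (hc : c ∈ Ico (0 : ℝ) 1)
    (hf : ∀ x, f x ∈ Icc (0 : ℝ) 1) {L : ℝ}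
    (hL : ∀ u v, 0 ≤ u → 0 ≤ v → ∀ ν,
      |expLogGenHeat α c f v ν - expLogGenHeat α c f u ν| ≤ L * |v - u|)
    {w u : ℝ} (hw : 0 < w) (hwu : w ≤ u) (ν : ProbabilityMeasure (EuclideanSpace ℝ (Fin d))) :
    |expLogHeat α c f w ν - expLogHeat α c f u ν + (u - w) * expLogGenHeat α c f u ν|
      ≤ L * (u - w) ^ 2 := by
  have hL0 : 0 ≤ L := by simpa using (abs_nonneg _).trans (hL 0 1 le_rfl zero_le_one ν)
  have h1 := Convex.norm_image_sub_le_of_norm_hasDerivWithin_le (s := Icc w u)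
    (f := fun v => expLogHeat α c f v ν - v * expLogGenHeat α c f u ν)
    (f' := fun v => expLogGenHeat α c f v ν - 1 * expLogGenHeat α c f u ν) (C := L * (u - w))
    (fun v hv => ((hft.hasDerivAt_expLogHeat hα hc hf (hw.trans_le hv.1) ν).sub
      ((hasDerivAt_id v).mul_const _)).hasDerivWithinAt)
    (fun v hv => by
      have := hL u v (hw.le.trans hwu) (hw.le.trans hv.1) ν
      rw [one_mul]
      refine this.trans (mul_le_mul_of_nonneg_left ?_ hL0)
      rw [abs_sub_comm, abs_of_nonneg (by linarith [hv.2])]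
      linarith [hv.1]) (convex_Icc _ _) (right_mem_Icc.2 hwu) (left_mem_Icc.2 hwu)
  rw [Real.norm_eq_abs, Real.norm_eq_abs, abs_sub_comm w u,
    abs_of_nonneg (sub_nonneg.2 hwu)] at h1
  calc _ = |expLogHeat α c f w ν - w * expLogGenHeat α c f u ν
        - (expLogHeat α c f u ν - u * expLogGenHeat α c f u ν)| := by congr 1; ring
    _ ≤ _ := h1.trans (le_of_eq (by ring))

end HeatFlow

section Duality

variable {d : ℕ} {T α c t : ℝ} {Ω : Type*} {mΩ : MeasurableSpace Ω} {P : Measure Ω}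
  {ℱ : Filtration ℝ mΩ} {μ0 : ProbabilityMeasure (EuclideanSpace ℝ (Fin d))}
  {μ : ℝ → Ω → ProbabilityMeasure (EuclideanSpace ℝ (Fin d))}
  {f : EuclideanSpace ℝ (Fin d) → ℝ} [IsProbabilityMeasure P]

lemma IsMPSolution.continuousOn_integral_expLogHeat (h : IsMPSolution d T α ℱ P μ0 μ)
    (hα : 0 < α) (hc : c ∈ Ico (0 : ℝ) 1) (hft : IsTest f) (hf : ∀ x, f x ∈ Icc (0 : ℝ) 1)
    (htT : t ≤ T) :
    ContinuousOn (fun s => ∫ ω, expLogHeat α c f (t - s) (μ s ω) ∂P) (Icc 0 t) := by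
  obtain ⟨L, hL⟩ := hft.exists_lipschitz_expLogHeat hα hc hf
  have hf1 : ∀ x, |f x| ≤ 1 := fun x => by rw [abs_of_nonneg (hf x).1]; exact (hf x).2
  refine continuousOn_of_dominated (bound := fun _ => Real.exp (|α| * -Real.log (1 - c)))
    (fun s hs => (h.dynkinFormula_heat hc hf hft hα (sub_nonneg.2 hs.2)).meas s
      ⟨hs.1, hs.2.trans htT⟩)
    (fun s _ => ae_of_all _ fun ω => ?_) (integrable_const _) ?_
  · rw [Real.norm_eq_abs, expLogHeat, abs_of_pos (expLog_pos _)]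
    exact expLog_le hc (heat_mem_Icc hf) _
  · filter_upwards [h.cont] with ω hω s hs
    have h1 : ContinuousWithinAt (fun r => expLogHeat α c f (t - s) (μ r ω)) (Icc 0 t) s :=
      ((continuous_expLog hc (heat_mem_Icc hf)
        (continuous_heat_space hft.continuous hf1)).comp_continuousOn
        (hω.mono (Icc_subset_Icc_right htT))) s hs
    have h2 : Tendsto (fun r => expLogHeat α c f (t - r) (μ r ω)
        - expLogHeat α c f (t - s) (μ r ω)) (nhdsWithin s (Icc 0 t)) (nhds 0) := by
      have h3 : Tendsto (fun r => L * |t - r - (t - s)|) (nhdsWithin s (Icc 0 t)) (nhds 0) := by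
        have : Continuous fun r => L * |t - r - (t - s)| := by fun_prop
        simpa using (this.tendsto s).mono_left nhdsWithin_le_nhds
      refine squeeze_zero_norm' ?_ h3
      filter_upwards [self_mem_nhdsWithin] with r hr
      exact (hL _ _ (sub_nonneg.2 hs.2) (sub_nonneg.2 hr.2) _).1
    have h4 := h1.tendsto.add h2
    simpa [ContinuousWithinAt] using h4

lemma IsMPSolution.hasDerivWithinAt_integral_expLogHeat (h : IsMPSolution d T α ℱ P μ0 μ)
    (hα : 0 < α) (hc : c ∈ Ico (0 : ℝ) 1) (hft : IsTest f) (hf : ∀ x, f x ∈ Icc (0 : ℝ) 1)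
    (htT : t ≤ T) {s : ℝ} (hs : s ∈ Ico 0 t) :
    HasDerivWithinAt (fun s => ∫ ω, expLogHeat α c f (t - s) (μ s ω) ∂P) 0 (Ici s) s := by
  obtain ⟨L, hL⟩ := hft.exists_lipschitz_expLogHeat hα hc hf
  obtain ⟨C, hC⟩ := hft.laplacian.exists_bound
  have hf1 : ∀ x, |f x| ≤ 1 := fun x => by rw [abs_of_nonneg (hf x).1]; exact (hf x).2
  set D := Real.exp (|α| * -Real.log (1 - c)) * (|-(c * α ^ 2 / 2)| * (C / (1 - c))) with hD
  have hGb : ∀ v ν, |expLogGenHeat α c f v ν| ≤ D := fun v ν =>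
    abs_expLogGen_le hc (heat_mem_Icc hf) (abs_heat_le hC) ν
  have hGc : ∀ v, Continuous (expLogGenHeat α c f v) := fun v =>
    continuous_expLogGen hc (heat_mem_Icc hf) (continuous_heat_space hft.continuous hf1)
      (continuous_heat_space hft.laplacian.continuous hC) (abs_heat_le hC)
  have hu : 0 < t - s := sub_pos.2 hs.2
  have hdy := fun {v : ℝ} (hv : 0 ≤ v) => h.dynkinFormula_heat hc hf hft hα hv
  have hint : ∀ {v r : ℝ}, 0 ≤ v → r ∈ Icc 0 T →
      Integrable (fun ω => expLogHeat α c f v (μ r ω)) P := fun {v r} hv hr =>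
    Integrable.of_bound ((hdy hv).meas r hr) (Real.exp (|α| * -Real.log (1 - c)))
      (ae_of_all _ fun ω => by
        rw [Real.norm_eq_abs, expLogHeat, abs_of_pos (expLog_pos _)]
        exact expLog_le hc (heat_mem_Icc hf) _)
  have hintI : ∀ {r : ℝ}, r ∈ Icc 0 T →
      Integrable (fun ω => ∫ q in (0 : ℝ)..r, expLogGenHeat α c f (t - s) (μ q ω)) P :=
    fun {r} hr => Integrable.of_bound ((hdy hu.le).meas_integral r hr) (D * |r - 0|)
      (ae_of_all _ fun ω => IsDiffusion.abs_integral_le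
        (f := fun q ω => expLogGenHeat α c f (t - s) (μ q ω)) (fun q ω => hGb _ _) 0 r ω)
  have hsT : s ∈ Icc 0 T := ⟨hs.1, hs.2.le.trans htT⟩
  have h0T : (0 : ℝ) ∈ Icc 0 T := ⟨le_rfl, hs.1.trans (hs.2.le.trans htT)⟩
  let X : ℝ → Ω → ℝ := fun r ω => expLogHeat α c f (t - r) (μ r ω)
    - expLogHeat α c f (t - s) (μ r ω)
    + ((∫ q in (0 : ℝ)..r, expLogGenHeat α c f (t - s) (μ q ω))
      - ∫ q in (0 : ℝ)..s, expLogGenHeat α c f (t - s) (μ q ω))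
  have hXE : ∀ r ∈ Ioo s t, ∫ ω, (r - s)⁻¹ * X r ω ∂P
      = (r - s)⁻¹ * ((∫ ω, expLogHeat α c f (t - r) (μ r ω) ∂P)
        - ∫ ω, expLogHeat α c f (t - s) (μ s ω) ∂P) := by
    intro r hr
    have hrT : r ∈ Icc 0 T := ⟨hs.1.trans hr.1.le, hr.2.le.trans htT⟩
    have f1 : ∫ ω, (expLogHeat α c f (t - s) (μ r ω) - expLogHeat α c f (t - s) (μ 0 ω)) ∂P
        = ∫ ω, (∫ q in (0 : ℝ)..r, expLogGenHeat α c f (t - s) (μ q ω)) ∂P :=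
      (hdy hu.le).formula r hrT
    have f2 : ∫ ω, (expLogHeat α c f (t - s) (μ s ω) - expLogHeat α c f (t - s) (μ 0 ω)) ∂P
        = ∫ ω, (∫ q in (0 : ℝ)..s, expLogGenHeat α c f (t - s) (μ q ω)) ∂P :=
      (hdy hu.le).formula s hsT
    rw [integral_sub (hint hu.le hrT) (hint hu.le h0T)] at f1
    rw [integral_sub (hint hu.le hsT) (hint hu.le h0T)] at f2
    have g1 := integral_add ((hint (sub_nonneg.2 hr.2.le) hrT).sub (hint hu.le hrT))
      ((hintI hrT).sub (hintI hsT))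
    simp only [Pi.sub_apply] at g1
    rw [integral_sub (hint (sub_nonneg.2 hr.2.le) hrT) (hint hu.le hrT),
      integral_sub (hintI hrT) (hintI hsT)] at g1
    rw [integral_const_mul, g1, ← f1, ← f2]
    ring
  have hmem : Ioo s t ∈ nhdsWithin s (Ioi s) := Ioo_mem_nhdsGT hs.2
  rw [← hasDerivWithinAt_Ioi_iff_Ici, hasDerivWithinAt_iff_tendsto_slope' self_notMem_Ioi]
  have hlim : Tendsto (fun r => ∫ ω, (r - s)⁻¹ * X r ω ∂P) (nhdsWithin s (Ioi s))
      (nhds (∫ _, (0 : ℝ) ∂P)) := by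
    refine tendsto_integral_filter_of_dominated_convergence (fun _ => L + D) ?_ ?_
      (integrable_const _) ?_
    · filter_upwards [hmem] with r hr
      have hrT : r ∈ Icc 0 T := ⟨hs.1.trans hr.1.le, hr.2.le.trans htT⟩
      exact ((((hint (sub_nonneg.2 hr.2.le) hrT).sub (hint hu.le hrT)).add
        ((hintI hrT).sub (hintI hsT))).const_mul _).aestronglyMeasurable
    · filter_upwards [hmem] with r hr
      filter_upwards [h.cont] with ω hω
      have hrs : 0 < r - s := sub_pos.2 hr.1
      have b1 := (hL (t - s) (t - r) hu.le (sub_nonneg.2 hr.2.le) (μ r ω)).1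
      have b2 := IsDiffusion.abs_integral_sub_le (K := D)
        (f := fun q ω => expLogGenHeat α c f (t - s) (μ q ω)) (fun q ω => hGb _ _)
        ((hGc (t - s)).comp_continuousOn hω) hs.1 hr.1.le (hr.2.le.trans htT)
      rw [show t - r - (t - s) = -(r - s) by ring, abs_neg, abs_of_pos hrs] at b1
      rw [norm_mul, norm_inv, Real.norm_eq_abs, abs_of_pos hrs, inv_mul_le_iff₀ hrs]
      calc |X r ω| ≤ L * (r - s) + D * (r - s) := (abs_add_le _ _).trans (add_le_add b1 b2)
        _ = _ := by ring
    · filter_upwards [h.cont] with ω hω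
      have hGco : ContinuousOn (fun q => expLogGenHeat α c f (t - s) (μ q ω)) (Icc 0 T) :=
        (hGc (t - s)).comp_continuousOn hω
      have hsub : nhdsWithin s (Ioi s) ≤ nhdsWithin s (Icc 0 T) := by
        rw [nhdsWithin_le_iff]
        exact mem_of_superset hmem fun r hr => ⟨hs.1.trans hr.1.le, hr.2.le.trans htT⟩
      have hG1 : Tendsto (fun q => expLogGenHeat α c f (t - s) (μ q ω)) (nhdsWithin s (Ioi s))
          (nhds (expLogGenHeat α c f (t - s) (μ s ω))) := (hGco s hsT).mono_left hsub
      have hder : HasDerivWithinAt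
          (fun r => ∫ q in (0 : ℝ)..r, expLogGenHeat α c f (t - s) (μ q ω))
          (expLogGenHeat α c f (t - s) (μ s ω)) (Ioi s) s := by
        refine (intervalIntegral.integral_hasDerivWithinAt_right
          (IsDiffusion.intervalIntegrable_of_continuousOn hGco le_rfl hs.1 hsT.2) (t := Ioi s)
          ?_ hG1).mono Ioi_subset_Ici_self
        refine ⟨Ioo s t, hmem, ?_⟩
        exact (hGco.mono fun r hr => ⟨hs.1.trans hr.1.le, hr.2.le.trans htT⟩).aestronglyMeasurable
          measurableSet_Ioo
      rw [hasDerivWithinAt_iff_tendsto_slope' self_notMem_Ioi] at hder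
      have h1 : Tendsto (fun r => (r - s)⁻¹ * (expLogHeat α c f (t - r) (μ r ω)
          - expLogHeat α c f (t - s) (μ r ω)
          + (t - s - (t - r)) * expLogGenHeat α c f (t - s) (μ r ω)))
          (nhdsWithin s (Ioi s)) (nhds 0) := by
        have h3 : Tendsto (fun r => L * (r - s)) (nhdsWithin s (Ioi s)) (nhds 0) := by
          have : Continuous fun r => L * (r - s) := by fun_prop
          simpa using (this.tendsto s).mono_left nhdsWithin_le_nhds
        refine squeeze_zero_norm' ?_ h3
        filter_upwards [hmem] with r hr
        have hrs : 0 < r - s := sub_pos.2 hr.1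
        rw [norm_mul, norm_inv, Real.norm_eq_abs, abs_of_pos hrs, inv_mul_le_iff₀ hrs]
        refine (hft.abs_expLogHeat_sub_add_le hα hc hf (fun u v hu hv ν => (hL u v hu hv ν).2)
          (sub_pos.2 hr.2) (sub_le_sub_left hr.1.le t) (μ r ω)).trans (le_of_eq ?_)
        ring
      have h2 := (h1.add hder).sub hG1
      rw [zero_add, sub_self] at h2
      refine h2.congr' ?_
      filter_upwards [hmem] with r hr
      have hrs : r - s ≠ 0 := (sub_pos.2 hr.1).ne'
      simp only [X, slope_def_field]
      field_simp
      ring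
  rw [integral_zero] at hlim
  refine hlim.congr' ?_
  filter_upwards [hmem] with r hr
  rw [hXE r hr, slope_def_field, div_eq_inv_mul]

/-- Laplace duality with the heat semigroup. -/
lemma IsMPSolution.integral_expLog_eq (h : IsMPSolution d T α ℱ P μ0 μ)
    (hα : 0 < α) (hc : c ∈ Ico (0 : ℝ) 1) (hft : IsTest f) (hf : ∀ x, f x ∈ Icc (0 : ℝ) 1)
    (ht : 0 ≤ t) (htT : t ≤ T) :
    AEStronglyMeasurable (fun ω => expLog α c f (μ t ω)) P ∧
    ∫ ω, expLog α c f (μ t ω) ∂P = expLog α c (heat α t f) μ0 := by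
  refine ⟨(h.dynkinFormula_isTest hc hf hft).meas t ⟨ht, htT⟩, ?_⟩
  have h1 := constant_of_has_deriv_right_zero
    (h.continuousOn_integral_expLogHeat hα hc hft hf htT)
    (fun s hs => h.hasDerivWithinAt_integral_expLogHeat hα hc hft hf htT hs) t ⟨ht, le_rfl⟩
  simp only [sub_self, sub_zero, expLogHeat, heat_zero] at h1
  rw [h1]
  have h2 : ∀ᵐ ω ∂P, expLog α c (heat α t f) (μ 0 ω) = expLog α c (heat α t f) μ0 := by
    filter_upwards [h.init] with ω hω
    rw [hω]
  rw [integral_congr_ae h2]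
  simp

end Duality

section OpenSets

variable {d : ℕ} {U : Set (EuclideanSpace ℝ (Fin d))}

lemma indicator_one_mem_Icc (U : Set (EuclideanSpace ℝ (Fin d))) (x : EuclideanSpace ℝ (Fin d)) :
    U.indicator (fun _ => (1 : ℝ)) x ∈ Icc (0 : ℝ) 1 := by
  by_cases hx : x ∈ U <;> simp [hx]

lemma exists_isTest_tendsto_indicator (hU : IsOpen U) (hUb : Bornology.IsBounded U) :
    ∃ F : ℕ → EuclideanSpace ℝ (Fin d) → ℝ, (∀ n, IsTest (F n)) ∧
      (∀ n x, F n x ∈ Icc (0 : ℝ) 1) ∧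
      ∀ x, Tendsto (fun n => F n x) atTop (nhds (U.indicator (fun _ => 1) x)) := by
  obtain ⟨f, hfs, hfc, hfr⟩ := hU.exists_contDiff_support_eq (n := ⊤)
  have hf : ∀ x, f x ∈ Icc (0 : ℝ) 1 := fun x => hfr (mem_range_self x)
  have hsupp : HasCompactSupport f := by
    rw [HasCompactSupport, tsupport, hfs]
    exact hUb.isCompact_closure
  refine ⟨fun n x => 1 - (1 - f x) ^ n, fun n => ⟨?_, ?_⟩, fun n x => ⟨?_, ?_⟩, fun x => ?_⟩
  · exact contDiff_const.sub ((contDiff_const.sub hfc).pow n)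
  · exact hsupp.comp_left (g := fun y : ℝ => 1 - (1 - y) ^ n) (by simp)
  · exact sub_nonneg.2 (pow_le_one₀ (sub_nonneg.2 (hf x).2) (by linarith [(hf x).1]))
  · have := pow_nonneg (sub_nonneg.2 (hf x).2) n
    linarith
  · by_cases hx : x ∈ U
    · have h0 : f x ≠ 0 := by rwa [← Function.mem_support, hfs]
      have h1 : 0 < f x := lt_of_le_of_ne (hf x).1 h0.symm
      have := (tendsto_pow_atTop_nhds_zero_of_lt_one (sub_nonneg.2 (hf x).2)
        (by linarith : 1 - f x < 1)).const_sub 1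
      simpa [hx] using this
    · have h0 : f x = 0 := by rwa [← Function.notMem_support, hfs]
      simp [hx, h0]

lemma tendsto_heat {α v : ℝ} {F : ℕ → EuclideanSpace ℝ (Fin d) → ℝ}
    {f : EuclideanSpace ℝ (Fin d) → ℝ} (hFm : ∀ n, Measurable (F n))
    {C : ℝ} (hC : ∀ n x, |F n x| ≤ C) (hlim : ∀ x, Tendsto (fun n => F n x) atTop (nhds (f x)))
    (x : EuclideanSpace ℝ (Fin d)) :
    Tendsto (fun n => heat α v (F n) x) atTop (nhds (heat α v f x)) :=
  tendsto_integral_of_dominated_convergence (fun y => gaussDensity y * C)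
    (fun n => (integrable_gaussDensity_mul (hFm n) (hC n) x _).aestronglyMeasurable)
    (integrable_gaussDensity.mul_const C)
    (fun n => ae_of_all _ fun y => norm_gaussDensity_mul_le (hC n) _ y)
    (ae_of_all _ fun _ => (hlim _).const_mul _)

lemma expLog_indicator (α : ℝ) {c : ℝ} (hU : MeasurableSet U)
    (ν : ProbabilityMeasure (EuclideanSpace ℝ (Fin d))) :
    expLog α c (U.indicator fun _ => 1) ν = Real.exp (Real.log (1 - c)
      * (α * ((ν : Measure (EuclideanSpace ℝ (Fin d))) U).toReal)) := by
  rw [expLog, pairing]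
  congr 1
  have : (fun x => α * Real.log (1 - c * U.indicator (fun _ => (1 : ℝ)) x))
      = U.indicator fun _ => α * Real.log (1 - c) := by
    funext x
    by_cases hx : x ∈ U <;> simp [hx]
  rw [this, integral_indicator_const _ hU, smul_eq_mul, measureReal_def]
  ring

variable {T α c t : ℝ} {Ω : Type*} {mΩ : MeasurableSpace Ω} {P : Measure Ω}
  {ℱ : Filtration ℝ mΩ} {μ0 : ProbabilityMeasure (EuclideanSpace ℝ (Fin d))}
  {μ : ℝ → Ω → ProbabilityMeasure (EuclideanSpace ℝ (Fin d))} [IsProbabilityMeasure P]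

/-- Laplace transform of the mass of a bounded open set. -/
lemma IsMPSolution.integral_exp_mass_eq (h : IsMPSolution d T α ℱ P μ0 μ)
    (hα : 0 < α) (hU : IsOpen U) (hUb : Bornology.IsBounded U) (hc : c ∈ Ico (0 : ℝ) 1)
    (ht : 0 ≤ t) (htT : t ≤ T) :
    AEStronglyMeasurable (fun ω => Real.exp (Real.log (1 - c)
      * (α * ((μ t ω : Measure (EuclideanSpace ℝ (Fin d))) U).toReal))) P ∧
    ∫ ω, Real.exp (Real.log (1 - c)
      * (α * ((μ t ω : Measure (EuclideanSpace ℝ (Fin d))) U).toReal)) ∂P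
      = expLog α c (heat α t (U.indicator fun _ => 1)) μ0 := by
  obtain ⟨F, hFt, hF, hlim⟩ := exists_isTest_tendsto_indicator hU hUb
  have hF1 : ∀ n x, |F n x| ≤ 1 := fun n x => by
    rw [abs_of_nonneg (hF n x).1]; exact (hF n x).2
  simp only [← expLog_indicator α hU.measurableSet]
  have h1 := fun n => h.integral_expLog_eq hα hc (hFt n) (hF n) ht htT
  have h2 := fun ω => tendsto_expLog (α := α) hc hF (fun n => (hFt n).continuous.measurable)
    (indicator_one_mem_Icc U) hlim (μ t ω)
  refine ⟨aestronglyMeasurable_of_tendsto_ae atTop (fun n => (h1 n).1) (ae_of_all _ h2), ?_⟩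
  have h3 := tendsto_integral_of_dominated_convergence (μ := P)
    (fun _ => Real.exp (|α| * -Real.log (1 - c))) (fun n => (h1 n).1) (integrable_const _)
    (fun n => ae_of_all _ fun ω => by
      rw [Real.norm_eq_abs, abs_of_pos (expLog_pos _)]
      exact expLog_le hc (hF n) _) (ae_of_all _ h2)
  have h4 := tendsto_expLog (α := α) hc (G := fun n => heat α t (F n))
    (fun n => heat_mem_Icc (hF n))
    (fun n => (continuous_heat_space (hFt n).continuous (hF1 n)).measurable)
    (heat_mem_Icc (indicator_one_mem_Icc U))
    (tendsto_heat (fun n => (hFt n).continuous.measurable) hF1 hlim) μ0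
  exact tendsto_nhds_unique (h3.congr fun n => (h1 n).2) h4

lemma setIntegral_gaussDensity_pos (a : EuclideanSpace ℝ (Fin d)) {r : ℝ} (hr : 0 < r) :
    0 < ∫ y in Metric.ball a r, gaussDensity y := by
  rw [setIntegral_pos_iff_support_of_nonneg_ae (ae_of_all _ fun y => (gaussDensity_pos y).le)
    integrable_gaussDensity.integrableOn]
  have : Function.support (gaussDensity (d := d)) = univ :=
    eq_univ_of_forall fun y => (gaussDensity_pos y).ne'
  rw [this, univ_inter]
  exact Metric.measure_ball_pos _ _ hr

lemma heat_indicator_le_of_disjoint {α v : ℝ} (hU : MeasurableSet U)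
    {x a : EuclideanSpace ℝ (Fin d)} {r : ℝ}
    (hdisj : ∀ y ∈ Metric.ball a r, x - √(α * v) • y ∉ U) :
    heat α v (U.indicator fun _ => 1) x ≤ 1 - ∫ y in Metric.ball a r, gaussDensity y := by
  have hi1 := integrable_gaussDensity_mul (f := U.indicator fun _ => (1 : ℝ)) (C := 1)
    (measurable_const.indicator hU)
    (fun x => by rw [abs_of_nonneg (indicator_one_mem_Icc U x).1]
                 exact (indicator_one_mem_Icc U x).2) x √(α * v)
  have hi2 : Integrable ((Metric.ball a r).indicator (gaussDensity (d := d))) :=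
    integrable_gaussDensity.indicator measurableSet_ball
  have e : 1 - ∫ y in Metric.ball a r, gaussDensity y
      = ∫ y, (gaussDensity y - (Metric.ball a r).indicator gaussDensity y) := by
    rw [integral_sub integrable_gaussDensity hi2, integral_gaussDensity,
      integral_indicator measurableSet_ball]
  rw [e]
  refine integral_mono hi1 (integrable_gaussDensity.sub hi2) fun y => ?_
  have hp := (gaussDensity_pos y).le
  by_cases hy : y ∈ Metric.ball a r
  · simp [hy, hdisj y hy]
  · by_cases hx : x - √(α * v) • y ∈ U <;> simp [hy, hx, hp]

/-- The heat flow of the indicator of a bounded set stays uniformly below one. -/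
lemma exists_heat_indicator_le (hd : 1 ≤ d) {α v : ℝ} (hα : 0 < α) (hv : 0 < v)
    (hU : MeasurableSet U) (hUb : Bornology.IsBounded U) :
    ∃ δ > 0, ∀ x, heat α v (U.indicator fun _ => 1) x ≤ 1 - δ := by
  obtain ⟨R, hR0, hR⟩ := hUb.subset_ball_lt 0 0
  set σ := √(α * v) with hσ
  have hσ0 : 0 < σ := Real.sqrt_pos.2 (mul_pos hα hv)
  set b : EuclideanSpace ℝ (Fin d) := EuclideanSpace.single ⟨0, hd⟩ (2 * R / σ + 2) with hb
  have hbn : ‖b‖ = 2 * R / σ + 2 := by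
    rw [hb, PiLp.norm_single, Real.norm_eq_abs, abs_of_pos (by positivity)]
  refine ⟨min (∫ y in Metric.ball (0 : EuclideanSpace ℝ (Fin d)) 1, gaussDensity y)
    (∫ y in Metric.ball b 1, gaussDensity y), lt_min (setIntegral_gaussDensity_pos 0 one_pos)
    (setIntegral_gaussDensity_pos b one_pos), fun x => ?_⟩
  by_cases h0 : ∀ y ∈ Metric.ball (0 : EuclideanSpace ℝ (Fin d)) 1, x - σ • y ∉ U
  · exact (heat_indicator_le_of_disjoint hU h0).trans (sub_le_sub_left (min_le_left _ _) _)
  · refine (heat_indicator_le_of_disjoint (a := b) (r := 1) hU fun z hz hzU => h0 ?_).trans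
      (sub_le_sub_left (min_le_right _ _) _)
    intro y hy hyU
    have h1 := mem_ball_zero_iff.1 (hR hyU)
    have h2 := mem_ball_zero_iff.1 (hR hzU)
    have h3 := mem_ball_zero_iff.1 hy
    have h4 := mem_ball_iff_norm.1 hz
    have h5 : ‖σ • (z - y)‖ < 2 * R := by
      calc ‖σ • (z - y)‖ = ‖(x - σ • y) - (x - σ • z)‖ := by congr 1; module
        _ ≤ ‖x - σ • y‖ + ‖x - σ • z‖ := norm_sub_le _ _
        _ < 2 * R := by linarith
    rw [norm_smul, Real.norm_eq_abs, abs_of_pos hσ0, ← lt_div_iff₀' hσ0] at h5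
    have h6 : ‖b‖ ≤ ‖z - y‖ + ‖y‖ + ‖z - b‖ := by
      calc ‖b‖ = ‖(z - y) + y - (z - b)‖ := by congr 1; module
        _ ≤ ‖(z - y) + y‖ + ‖z - b‖ := norm_sub_le _ _
        _ ≤ _ := by gcongr; exact norm_add_le _ _
    linarith

end OpenSets

section Integrality

variable {E : Type*} {p : E → ℝ} {δ : ℝ}

lemma le_re_one_sub_add_mul_exp (hp : ∀ x, p x ∈ Icc 0 (1 - δ)) (hδ : 0 < δ) (z : ℂ) (x : E) :
    δ - Real.exp z.re ≤ (1 - p x + p x * Complex.exp z : ℂ).re := by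
  have h1 : |(Complex.exp z).re| ≤ Real.exp z.re := by
    rw [← Complex.norm_exp]; exact Complex.abs_re_le_norm _
  have h2 := (hp x).1
  have h3 := (hp x).2
  simp only [Complex.add_re, Complex.sub_re, Complex.one_re, Complex.ofReal_re,
    Complex.re_ofReal_mul]
  nlinarith [neg_le_of_abs_le h1, Real.exp_pos z.re]

lemma norm_log_one_sub_add_mul_exp_le (hp : ∀ x, p x ∈ Icc 0 (1 - δ)) (hδ : 0 < δ) {z : ℂ}
    (hz : Real.exp z.re < δ) (x : E) :
    ‖Complex.log (1 - p x + p x * Complex.exp z)‖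
      ≤ max |Real.log (δ - Real.exp z.re)| |Real.log 2| + Real.pi := by
  have h0 := sub_pos.2 hz
  have h1 := le_re_one_sub_add_mul_exp hp hδ z x
  have h2 : δ - Real.exp z.re ≤ ‖(1 - p x + p x * Complex.exp z : ℂ)‖ :=
    h1.trans (Complex.re_le_norm _)
  have hp1 := (hp x).1
  have hp2 := (hp x).2
  have h3 : ‖(1 - p x + p x * Complex.exp z : ℂ)‖ ≤ 2 := by
    have e1 : ‖(1 - p x : ℂ)‖ = 1 - p x := by
      rw [← Complex.ofReal_one, ← Complex.ofReal_sub, Complex.norm_real, Real.norm_eq_abs,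
        abs_of_nonneg (by linarith)]
    have e2 : ‖(p x * Complex.exp z : ℂ)‖ = p x * Real.exp z.re := by
      rw [norm_mul, Complex.norm_exp, Complex.norm_real, Real.norm_eq_abs, abs_of_nonneg hp1]
    refine (norm_add_le _ _).trans ?_
    rw [e1, e2]
    nlinarith [Real.exp_pos z.re]
  refine (Complex.norm_le_abs_re_add_abs_im _).trans (add_le_add ?_ ?_)
  · rw [Complex.log_re]
    exact abs_le_max_abs_abs (Real.log_le_log h0 h2) (Real.log_le_log (h0.trans_le h2) h3)
  · rw [Complex.log_im]
    exact Complex.abs_arg_le_pi _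

variable [MeasurableSpace E] {ν : Measure E}

lemma measurable_log_one_sub_add_mul_exp (hpm : Measurable p) (z : ℂ) :
    Measurable (fun x => Complex.log (1 - p x + p x * Complex.exp z)) :=
  Complex.measurable_log.comp (by fun_prop)

lemma ofReal_integral_log (hp : ∀ x, p x ∈ Icc 0 (1 - δ)) (hδ : 0 < δ) (z : ℝ) :
    ((∫ x, Real.log (1 - p x + p x * Real.exp z) ∂ν : ℝ) : ℂ)
      = ∫ x, Complex.log (1 - p x + p x * Complex.exp z) ∂ν := by
  rw [← integral_complex_ofReal]
  congr 1 with x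
  have h : 0 ≤ 1 - p x + p x * Real.exp z := by
    have := (hp x).1
    have := (hp x).2
    have := Real.exp_pos z
    nlinarith [mul_nonneg (hp x).1 this.le]
  rw [Complex.ofReal_log h]
  push_cast
  rfl

variable [IsProbabilityMeasure ν]

lemma integrable_log_one_sub_add_mul_exp (hpm : Measurable p) (hp : ∀ x, p x ∈ Icc 0 (1 - δ))
    (hδ : 0 < δ) {z : ℂ} (hz : Real.exp z.re < δ) :
    Integrable (fun x => Complex.log (1 - p x + p x * Complex.exp z)) ν :=
  Integrable.of_bound (measurable_log_one_sub_add_mul_exp hpm z).aestronglyMeasurable _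
    (ae_of_all _ fun x => norm_log_one_sub_add_mul_exp_le hp hδ hz x)

lemma hasDerivAt_integral_log (hpm : Measurable p) (hp : ∀ x, p x ∈ Icc 0 (1 - δ)) (hδ : 0 < δ)
    {z : ℂ} (hz : Real.exp z.re < δ) :
    HasDerivAt (fun z : ℂ => ∫ x, Complex.log (1 - p x + p x * Complex.exp z) ∂ν)
      (∫ x, p x * Complex.exp z / (1 - p x + p x * Complex.exp z) ∂ν) z := by
  obtain ⟨e, he1, he2⟩ := exists_between hz
  have hs : {w : ℂ | Real.exp w.re < e} ∈ nhds z :=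
    (isOpen_lt (by fun_prop) continuous_const).mem_nhds he1
  refine (hasDerivAt_integral_of_dominated_loc_of_deriv_le (μ := ν) hs
    (F := fun z x => Complex.log (1 - p x + p x * Complex.exp z))
    (F' := fun z x => p x * Complex.exp z / (1 - p x + p x * Complex.exp z))
    (bound := fun _ => e / (δ - e)) (Eventually.of_forall fun w =>
      (measurable_log_one_sub_add_mul_exp hpm w).aestronglyMeasurable)
    (integrable_log_one_sub_add_mul_exp hpm hp hδ hz)
    (by fun_prop : Measurable _).aestronglyMeasurable
    (ae_of_all _ fun x w hw => ?_) (integrable_const _) (ae_of_all _ fun x w hw => ?_)).2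
  · have hw' : Real.exp w.re < e := hw
    have hp1 := (hp x).1
    have hp2 := (hp x).2
    have h1 := (le_re_one_sub_add_mul_exp hp hδ w x).trans (Complex.re_le_norm _)
    rw [norm_div, norm_mul, Complex.norm_exp, Complex.norm_real, Real.norm_eq_abs,
      abs_of_nonneg hp1]
    refine div_le_div₀ (he1.trans_le' (Real.exp_pos _).le).le ?_ (sub_pos.2 he2) (by linarith)
    nlinarith [Real.exp_pos w.re]
  · have hw' : Real.exp w.re < e := hw
    have h1 := le_re_one_sub_add_mul_exp hp hδ w x
    have h2 : HasDerivAt (fun w : ℂ => 1 - p x + p x * Complex.exp w) (p x * Complex.exp w) w :=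
      ((Complex.hasDerivAt_exp w).const_mul _).const_add _
    exact h2.clog (Or.inl (by linarith))

variable {Ω : Type*} {mΩ : MeasurableSpace Ω} {P : Measure Ω} [IsProbabilityMeasure P]
  {X : Ω → ℝ}

/-- A bounded random variable whose Laplace transform is that of a Poisson-binomial-like law is
integer valued. -/
lemma ae_exists_int_of_mgf_eq {α K : ℝ} (hX : AEMeasurable X P) (hXK : ∀ ω, |X ω| ≤ K)
    (hpm : Measurable p) (hp : ∀ x, p x ∈ Icc 0 (1 - δ)) (hδ : 0 < δ)
    (h : ∀ z : ℝ, z ≤ 0 → ∫ ω, Real.exp (z * X ω) ∂P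
      = Real.exp (∫ x, α * Real.log (1 - p x + p x * Real.exp z) ∂ν)) :
    ∀ᵐ ω ∂P, ∃ k : ℤ, X ω = k := by
  have hexp : ∀ z : ℝ, Integrable (fun ω => Real.exp (z * X ω)) P := fun z =>
    Integrable.of_bound (by fun_prop) (Real.exp (|z| * K)) (ae_of_all _ fun ω => by
      rw [Real.norm_eq_abs, abs_of_pos (Real.exp_pos _), Real.exp_le_exp]
      refine (le_abs_self _).trans ?_
      rw [abs_mul]
      exact mul_le_mul_of_nonneg_left (hXK ω) (abs_nonneg _))
  have hset : integrableExpSet X P = univ := eq_univ_of_forall hexp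
  set D : Set ℂ := {z : ℂ | z.re < min 0 (Real.log δ)} with hD
  have hDo : IsOpen D := isOpen_lt Complex.continuous_re continuous_const
  have hDc : IsPreconnected D := (convex_halfSpace_re_lt _).isPreconnected
  have hDδ : ∀ z ∈ D, Real.exp z.re < δ := fun z hz =>
    (Real.lt_log_iff_exp_lt hδ).1 (lt_of_lt_of_le hz (min_le_right _ _))
  let Φ : ℂ → ℂ := fun z =>
    Complex.exp (α * ∫ x, Complex.log (1 - p x + p x * Complex.exp z) ∂ν)
  have hΦ : AnalyticOnNhd ℂ Φ D := by
    refine DifferentiableOn.analyticOnNhd (fun z hz => ?_) hDo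
    exact ((hasDerivAt_integral_log hpm hp hδ (hDδ z hz)).const_mul
      (α : ℂ)).cexp.differentiableAt.differentiableWithinAt
  have hM : AnalyticOnNhd ℂ (complexMGF X P) D := fun z _ =>
    analyticAt_complexMGF (by simp [hset])
  have hreal : ∀ z : ℝ, z ≤ 0 → complexMGF X P z = Φ z := fun z hz => by
    rw [complexMGF_ofReal, mgf, h z hz, integral_const_mul, Complex.ofReal_exp,
      Complex.ofReal_mul, ofReal_integral_log hp hδ]
  set x₀ : ℝ := min 0 (Real.log δ) - 1 with hx₀
  have hx₀0 : x₀ < 0 := by linarith [min_le_left 0 (Real.log δ)]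
  have hx₀D : (x₀ : ℂ) ∈ D := by
    change (x₀ : ℂ).re < _
    rw [Complex.ofReal_re]; linarith
  have hfreq : ∃ᶠ z in nhdsWithin (x₀ : ℂ) {(x₀ : ℂ)}ᶜ, complexMGF X P z = Φ z := by
    have ht : Tendsto (fun x : ℝ => (x : ℂ)) (nhdsWithin x₀ {x₀}ᶜ)
        (nhdsWithin (x₀ : ℂ) {(x₀ : ℂ)}ᶜ) := by
      refine tendsto_nhdsWithin_of_tendsto_nhds_of_eventually_within _
        (Complex.continuous_ofReal.continuousAt.tendsto.mono_left nhdsWithin_le_nhds) ?_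
      filter_upwards [self_mem_nhdsWithin] with x hx
      simpa using hx
    refine ht.frequently (Eventually.frequently ?_)
    filter_upwards [mem_nhdsWithin_of_mem_nhds (Iio_mem_nhds hx₀0)] with x hx
    exact hreal x (le_of_lt hx)
  have heq := hM.eqOn_of_preconnected_of_frequently_eq hΦ hDc hx₀D hfreq
  have hshift : complexMGF X P (x₀ + 2 * Real.pi * Complex.I) = complexMGF X P x₀ := by
    rw [heq hx₀D, heq (by
      change ((x₀ : ℂ) + 2 * Real.pi * Complex.I).re < _
      simpa using ⟨hx₀0, (lt_min_iff.1 (sub_one_lt (min 0 (Real.log δ)))).2⟩)]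
    simp only [Φ, Complex.exp_periodic _]
  have hint : Integrable (fun ω => Complex.exp ((x₀ + 2 * Real.pi * Complex.I) * X ω)) P := by
    refine (hexp x₀).mono' (by fun_prop) (ae_of_all _ fun ω => ?_)
    rw [Complex.norm_exp]
    simp
  have hre : ∀ ω, (Complex.exp ((x₀ + 2 * Real.pi * Complex.I) * X ω)).re
      = Real.exp (x₀ * X ω) * Real.cos (X ω * (2 * Real.pi)) := fun ω => by
    rw [Complex.exp_re]
    simp
    congr 1; ring
  have hcosi : Integrable (fun ω => Real.exp (x₀ * X ω) * Real.cos (X ω * (2 * Real.pi))) P :=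
    (hint.re).congr (ae_of_all _ hre)
  have hzero : ∫ ω, (Real.exp (x₀ * X ω)
      - Real.exp (x₀ * X ω) * Real.cos (X ω * (2 * Real.pi))) ∂P = 0 := by
    rw [integral_sub (hexp x₀) hcosi, sub_eq_zero]
    have h1 := congrArg Complex.re hshift
    rw [re_complexMGF_ofReal, complexMGF] at h1
    have h2 := integral_re hint
    simp only [RCLike.re_eq_complex_re, hre] at h2
    rw [h2]
    exact h1.symm
  have hnn : 0 ≤ fun ω => Real.exp (x₀ * X ω)
      - Real.exp (x₀ * X ω) * Real.cos (X ω * (2 * Real.pi)) := fun ω =>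
    sub_nonneg.2 (mul_le_of_le_one_right (Real.exp_pos _).le (Real.cos_le_one _))
  filter_upwards [(integral_eq_zero_iff_of_nonneg hnn ((hexp x₀).sub hcosi)).1 hzero] with ω hω
  have h1 : Real.exp (x₀ * X ω)
      - Real.exp (x₀ * X ω) * Real.cos (X ω * (2 * Real.pi)) = 0 := hω
  have h2 : Real.exp (x₀ * X ω) * (1 - Real.cos (X ω * (2 * Real.pi))) = 0 := by linarith
  have h3 := (mul_eq_zero.1 h2).resolve_left (Real.exp_pos _).ne'
  obtain ⟨k, hk⟩ := (Real.cos_eq_one_iff _).1 (sub_eq_zero.1 h3).symm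
  exact ⟨k, (mul_right_cancel₀ Real.two_pi_pos.ne' hk).symm⟩

end Integrality

section Conclusion

variable {d : ℕ} {U : Set (EuclideanSpace ℝ (Fin d))} {T α t : ℝ}

lemma measurable_heat_indicator {v : ℝ} (hU : IsOpen U) (hUb : Bornology.IsBounded U) :
    Measurable (heat α v (U.indicator fun _ => 1)) := by
  obtain ⟨F, hFt, hF, hlim⟩ := exists_isTest_tendsto_indicator hU hUb
  have hF1 : ∀ n x, |F n x| ≤ 1 := fun n x => by
    rw [abs_of_nonneg (hF n x).1]; exact (hF n x).2
  exact measurable_of_tendsto_metrizable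
    (fun n => (continuous_heat_space (hFt n).continuous (hF1 n)).measurable)
    (tendsto_pi_nhds.2 (tendsto_heat (fun n => (hFt n).continuous.measurable) hF1 hlim))

variable {Ω : Type*} {mΩ : MeasurableSpace Ω} {P : Measure Ω}
  {ℱ : Filtration ℝ mΩ} {μ0 : ProbabilityMeasure (EuclideanSpace ℝ (Fin d))}
  {μ : ℝ → Ω → ProbabilityMeasure (EuclideanSpace ℝ (Fin d))} [IsProbabilityMeasure P]

lemma IsMPSolution.aemeasurable_mass (h : IsMPSolution d T α ℱ P μ0 μ)
    (hα : 0 < α) (hU : IsOpen U) (hUb : Bornology.IsBounded U) (ht : 0 ≤ t) (htT : t ≤ T) :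
    AEMeasurable (fun ω => α * ((μ t ω : Measure (EuclideanSpace ℝ (Fin d))) U).toReal) P := by
  have hlog : Real.log (1 - 1 / 2) ≠ 0 := (Real.log_neg (by norm_num) (by norm_num)).ne
  have h1 := (h.integral_exp_mass_eq hα hU hUb (c := 1 / 2) (by norm_num) ht htT).1
  refine (h1.aemeasurable.log.div_const (Real.log (1 - 1 / 2))).congr (ae_of_all _ fun ω => ?_)
  simp only [Real.log_exp]
  exact mul_div_cancel_left₀ _ hlog

/-- The rescaled mass of a bounded open set is almost surely an integer. -/
lemma IsMPSolution.ae_exists_int_of_isOpen_of_isBounded (h : IsMPSolution d T α ℱ P μ0 μ)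
    (hd : 1 ≤ d) (hα : 0 < α) (hU : IsOpen U) (hUb : Bornology.IsBounded U)
    (ht : 0 < t) (htT : t ≤ T) :
    ∀ᵐ ω ∂P, ∃ k : ℤ,
      α * ((μ t ω : Measure (EuclideanSpace ℝ (Fin d))) U).toReal = k := by
  obtain ⟨δ, hδ, hle⟩ := exists_heat_indicator_le hd hα ht hU.measurableSet hUb
  refine ae_exists_int_of_mgf_eq (ν := (μ0 : Measure (EuclideanSpace ℝ (Fin d)))) (K := α) (α := α)
    (h.aemeasurable_mass hα hU hUb ht.le htT) (fun ω => ?_)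
    (measurable_heat_indicator (α := α) (v := t) hU hUb)
    (fun x => ⟨(heat_mem_Icc (indicator_one_mem_Icc U) x).1, hle x⟩) hδ (fun z hz => ?_)
  · rw [abs_of_nonneg (by positivity)]
    exact mul_le_of_le_one_right hα.le measureReal_le_one
  · have hc : 1 - Real.exp z ∈ Ico (0 : ℝ) 1 :=
      ⟨sub_nonneg.2 (Real.exp_le_one_iff.2 hz), sub_lt_self _ (Real.exp_pos z)⟩
    have h1 := (h.integral_exp_mass_eq hα hU hUb hc ht.le htT).2
    rw [sub_sub_cancel, Real.log_exp] at h1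
    rw [h1, expLog, pairing]
    congr 3 with x
    congr 2
    ring

lemma exists_int_of_tendsto {u : ℕ → ℝ} {a : ℝ} (hu : ∀ n, ∃ k : ℤ, u n = k)
    (h : Tendsto u atTop (nhds a)) : ∃ k : ℤ, a = k := by
  obtain ⟨k, hk⟩ := Int.isClosedEmbedding_coe_real.isClosed_range.mem_of_tendsto h
    (Eventually.of_forall fun n => (hu n).imp fun _ hk => hk.symm)
  exact ⟨k, hk.symm⟩

/-- The rescaled mass of a Borel set is almost surely an integer. -/
lemma IsMPSolution.ae_exists_int (h : IsMPSolution d T α ℱ P μ0 μ)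
    (hd : 1 ≤ d) (hα : 0 < α) (ht : 0 < t) (htT : t ≤ T)
    {A : Set (EuclideanSpace ℝ (Fin d))} (hA : MeasurableSet A) :
    ∀ᵐ ω ∂P, ∃ k : ℤ,
      α * ((μ t ω : Measure (EuclideanSpace ℝ (Fin d))) A).toReal = k := by
  have hopen : ∀ V : Set (EuclideanSpace ℝ (Fin d)), IsOpen V → ∀ᵐ ω ∂P, ∃ k : ℤ,
      α * ((μ t ω : Measure (EuclideanSpace ℝ (Fin d))) V).toReal = k := fun V hV => by
    have hball : ∀ᵐ ω ∂P, ∀ n : ℕ, ∃ k : ℤ,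
        α * ((μ t ω : Measure (EuclideanSpace ℝ (Fin d))) (V ∩ Metric.ball 0 n)).toReal = k :=
      ae_all_iff.2 fun n => h.ae_exists_int_of_isOpen_of_isBounded hd hα
        (hV.inter Metric.isOpen_ball) (Metric.isBounded_ball.subset inter_subset_right) ht htT
    filter_upwards [hball] with ω hω
    have hmono : Monotone fun n : ℕ => V ∩ Metric.ball (0 : EuclideanSpace ℝ (Fin d)) n :=
      fun m n hmn => inter_subset_inter_right _ (Metric.ball_subset_ball (Nat.cast_le.2 hmn))
    have hlim := tendsto_measure_iUnion_atTop
      (μ := (μ t ω : Measure (EuclideanSpace ℝ (Fin d)))) hmono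
    rw [← inter_iUnion, Metric.iUnion_ball_nat, inter_univ] at hlim
    exact exists_int_of_tendsto hω
      (((ENNReal.tendsto_toReal (measure_ne_top _ _)).comp hlim).const_mul α)
  have hgen : (inferInstance : MeasurableSpace (EuclideanSpace ℝ (Fin d)))
      = MeasurableSpace.generateFrom {V | IsOpen V} := BorelSpace.measurable_eq
  refine MeasurableSpace.induction_on_inter (C := fun B _ => ∀ᵐ ω ∂P, ∃ k : ℤ,
      α * ((μ t ω : Measure (EuclideanSpace ℝ (Fin d))) B).toReal = k) hgen isPiSystem_isOpen
    (ae_of_all _ fun ω => ⟨0, by simp⟩) hopen (fun B hB ih => ?_) (fun f hdisj hf ih => ?_) A hA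
  · filter_upwards [ih, hopen univ isOpen_univ] with ω ⟨k, hk⟩ ⟨m, hm⟩
    refine ⟨m - k, ?_⟩
    rw [measure_compl hB (measure_ne_top _ _), ENNReal.toReal_sub_of_le
      (measure_mono (subset_univ B)) (measure_ne_top _ _), mul_sub, hk, hm, Int.cast_sub]
  · filter_upwards [ae_all_iff.2 ih] with ω hω
    choose k hk using hω
    have htsum := measure_iUnion (μ := (μ t ω : Measure (EuclideanSpace ℝ (Fin d)))) hdisj hf
    have hsum := ENNReal.hasSum_toReal (htsum ▸ measure_ne_top _ _)
    rw [← ENNReal.tsum_toReal_eq fun _ => measure_ne_top _ _, ← htsum] at hsum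
    refine exists_int_of_tendsto (fun n => ⟨∑ i ∈ Finset.range n, k i, ?_⟩)
      (hsum.mul_left α).tendsto_sum_nat
    simp [hk]

end Conclusion

/-- **Atomicity of Dean–Kawasaki solutions**: if `μ` solves `(MP)^α_{μ₀}`, then for every
bounded Borel set `A` and every `t ∈ (0,T]`, almost surely `α·μ_t(A)` is a nonnegative
integer; consequently, almost surely `μ_t(A) ∈ {0, 1/α, …, ⌊α⌋/α}`. -/
theorem mass_is_atomic
    {d : ℕ} (hd : 1 ≤ d) {T α : ℝ} (hT : 0 < T) (hα : 0 < α)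
    {Ω : Type*} [mΩ : MeasurableSpace Ω] {P : Measure Ω} [IsProbabilityMeasure P]
    {ℱ : Filtration ℝ mΩ} {μ0 : ProbabilityMeasure (EuclideanSpace ℝ (Fin d))}
    {μ : ℝ → Ω → ProbabilityMeasure (EuclideanSpace ℝ (Fin d))}
    (hsol : IsMPSolution d T α ℱ P μ0 μ)
    {A : Set (EuclideanSpace ℝ (Fin d))} (hAb : Bornology.IsBounded A)
    (hAm : MeasurableSet A) {t : ℝ} (ht0 : 0 < t) (htT : t ≤ T) :
    ∀ᵐ ω ∂P, ∃ k : ℕ, k ≤ ⌊α⌋₊ ∧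
      α * ((μ t ω : Measure (EuclideanSpace ℝ (Fin d))) A).toReal = k ∧
      ((μ t ω : Measure (EuclideanSpace ℝ (Fin d))) A).toReal = k / α := by
  filter_upwards [hsol.ae_exists_int hd hα ht0 htT hAm] with ω ⟨k, hk⟩
  have hk0 : 0 ≤ k := by
    rw [← Int.cast_nonneg_iff (R := ℝ), ← hk]
    positivity
  lift k to ℕ using hk0
  rw [Int.cast_natCast] at hk
  refine ⟨k, Nat.le_floor ?_, hk, ?_⟩
  · rw [← hk]
    exact mul_le_of_le_one_right hα.le measureReal_le_one
  · rw [← hk, mul_div_cancel_left₀ _ hα.ne']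

end
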